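/- arXiv:math/0703340 — 2 statements merged into one kernel-verified Lean document; each statement's English description precedes it below -/
import Mathlib

section
/- If a*_K ≥ 1 and 1 ≤ a ≤ a*_K, then every zero of φ_K(a,·) lies on the critical line: if s ∈ ℂ, s ∉ {0, 1, 2}, and φ_K(a,s) = 0, then Re(s) = 1. -/
open Complex Filter NumberField

/-- The Dedekind zeta function of a number field `K`, given (for `Re(s) > 1`) as the
sum of `N(I)^{-s}` over the nonzero ideals `I` of the ring of integers of `K`. -/
noncomputable def dedekindZetaSum (K : Type*) [Field K] [NumberField K] (s : ℂ) : ℂ :=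
  ∑' I : {I : Ideal (𝓞 K) // I ≠ ⊥}, (Ideal.absNorm I.1 : ℂ) ^ (-s)

/-- `ΛK` is the completed Dedekind zeta function of `K`:
`Λ_K(s) = (√|d_K|/(2π))^s Γ(s) ζ_K(s)` for `Re(s) > 1`, holomorphic away from
(simple) poles at `s = 0` and `s = 1`, and satisfying `Λ_K(s) = Λ_K(1-s)`. -/
structure IsCompletedDedekindZeta (K : Type*) [Field K] [NumberField K]
    (ΛK : ℂ → ℂ) : Prop where
  eq_on_gt_one : ∀ s : ℂ, 1 < s.re → ΛK s =
    ((Real.sqrt |(NumberField.discr K : ℝ)| / (2 * Real.pi) : ℝ) : ℂ) ^ s *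
      Complex.Gamma s * dedekindZetaSum K s
  differentiableOn : DifferentiableOn ℂ ΛK {(0 : ℂ), 1}ᶜ
  functional_equation : ∀ s : ℂ, ΛK s = ΛK (1 - s)
  simple_pole_at_one : ∃ r : ℂ, r ≠ 0 ∧
    Tendsto (fun s : ℂ => (s - 1) * ΛK s) (nhdsWithin 1 {(1 : ℂ)}ᶜ) (nhds r)

/-- The constant term `φ_K(a,s) = a^s Λ_K(s) + a^{2-s} Λ_K(s-1)` of the Eisenstein
series attached to `PSL(2, 𝓞_K)`. -/
noncomputable def phiK (ΛK : ℂ → ℂ) (a : ℝ) (s : ℂ) : ℂ :=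
  (a : ℂ) ^ s * ΛK s + (a : ℂ) ^ (2 - s) * ΛK (s - 1)

open Metric Set Topology ComplexConjugate in
theorem normSq_one_sub_conj_mul_sub_normSq_sub (α ζ : ℂ) :
    normSq (1 - conj α * ζ) - normSq (ζ - α) = (1 - normSq α) * (1 - normSq ζ) := by
  simp [normSq_apply]; ring

open ComplexConjugate in
theorem one_sub_conj_mul_ne_zero {α ζ : ℂ} (hα : ‖α‖ < 1) (hζ : ‖ζ‖ ≤ 1) :
    1 - conj α * ζ ≠ 0 := by
  intro h
  have h1 : ‖conj α * ζ‖ = 1 := by rw [← sub_eq_zero.mp h]; simp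
  rw [norm_mul, RCLike.norm_conj] at h1
  nlinarith [norm_nonneg α, norm_nonneg ζ]

open ComplexConjugate in
/-- The defect `1 - |M ζ|²` of a disc automorphism `M ζ = (ζ - α) / (1 - conj α ζ)`. -/
theorem one_sub_norm_sq_moebius {α ζ : ℂ} (hα : ‖α‖ < 1) (hζ : ‖ζ‖ ≤ 1) :
    1 - ‖(ζ - α) / (1 - conj α * ζ)‖ ^ 2 =
      (1 - ‖α‖ ^ 2) * (1 - ‖ζ‖ ^ 2) / ‖1 - conj α * ζ‖ ^ 2 := by
  have h := normSq_one_sub_conj_mul_sub_normSq_sub α ζ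
  have h0 : ‖1 - conj α * ζ‖ ≠ 0 := norm_ne_zero_iff.mpr (one_sub_conj_mul_ne_zero hα hζ)
  simp only [normSq_eq_norm_sq] at h
  rw [norm_div, div_pow, ← h, sub_div, div_self (pow_ne_zero 2 h0)]

open ComplexConjugate in
theorem norm_moebius_le_one {α ζ : ℂ} (hα : ‖α‖ < 1) (hζ : ‖ζ‖ ≤ 1) :
    ‖(ζ - α) / (1 - conj α * ζ)‖ ≤ 1 := by
  have h := one_sub_norm_sq_moebius hα hζ
  have h1 : 0 ≤ (1 - ‖α‖ ^ 2) * (1 - ‖ζ‖ ^ 2) / ‖1 - conj α * ζ‖ ^ 2 := by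
    have : 0 ≤ 1 - ‖α‖ ^ 2 := by nlinarith [norm_nonneg α]
    have : 0 ≤ 1 - ‖ζ‖ ^ 2 := by nlinarith [norm_nonneg ζ]
    positivity
  nlinarith [norm_nonneg ((ζ - α) / (1 - conj α * ζ))]

open Metric Set ComplexConjugate in
/-- A holomorphic self-map of the disc that is not unimodular at `0` approaches the unit circle
at most linearly. -/
theorem exists_mul_le_one_sub_norm_sq {h : ℂ → ℂ} (hd : DifferentiableOn ℂ h (ball 0 1))
    (hm : MapsTo h (ball 0 1) (closedBall 0 1)) (h0 : ‖h 0‖ < 1) :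
    ∃ κ > 0, ∀ z ∈ ball (0 : ℂ) 1, κ * (1 - ‖z‖ ^ 2) ≤ 1 - ‖h z‖ ^ 2 := by
  have hm' : ∀ z ∈ ball (0 : ℂ) 1, ‖h z‖ ≤ 1 := fun z hz ↦ by simpa using hm hz
  have hp : 0 < 1 - ‖h 0‖ ^ 2 := by nlinarith [norm_nonneg (h 0)]
  refine ⟨(1 - ‖h 0‖) ^ 2 / (1 - ‖h 0‖ ^ 2), div_pos (by nlinarith) hp, fun z hz ↦ ?_⟩
  have hF : ‖(h z - h 0) / (1 - conj (h 0) * h z)‖ ≤ ‖z‖ := by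
    refine norm_le_norm_of_mapsTo_ball (f := fun z ↦ (h z - h 0) / (1 - conj (h 0) * h z))
      (R := 1) ?_ ?_ (by simp) (by simpa using hz)
    · exact (hd.sub_const _).div ((hd.const_mul _).const_sub _)
        fun z hz ↦ one_sub_conj_mul_ne_zero h0 (hm' z hz)
    · intro z hz
      simpa using norm_moebius_le_one h0 (hm' z hz)
  have e := one_sub_norm_sq_moebius h0 (hm' z hz)
  have hz1 : ‖z‖ < 1 := by simpa using hz
  have hN : 1 - ‖h 0‖ ≤ ‖1 - conj (h 0) * h z‖ := by
    have h1 : ‖conj (h 0) * h z‖ ≤ ‖h 0‖ := by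
      rw [norm_mul, RCLike.norm_conj]
      exact mul_le_of_le_one_right (norm_nonneg _) (hm' z hz)
    have h2 := norm_sub_norm_le (1 : ℂ) (conj (h 0) * h z)
    rw [norm_one] at h2
    linarith
  have hN0 : 0 < ‖1 - conj (h 0) * h z‖ := by linarith
  have h3 : 1 - ‖z‖ ^ 2 ≤ (1 - ‖h 0‖ ^ 2) * (1 - ‖h z‖ ^ 2) / ‖1 - conj (h 0) * h z‖ ^ 2 := by
    rw [← e]
    have := pow_le_pow_left₀ (norm_nonneg _) hF 2
    linarith
  rw [le_div_iff₀ (by positivity)] at h3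
  rw [div_mul_eq_mul_div, div_le_iff₀ hp]
  have h4 : (1 - ‖h 0‖) ^ 2 ≤ ‖1 - conj (h 0) * h z‖ ^ 2 :=
    pow_le_pow_left₀ (by linarith) hN 2
  have h5 : 0 ≤ 1 - ‖z‖ ^ 2 := by nlinarith [norm_nonneg z]
  have h6 := mul_le_mul_of_nonneg_left h4 h5
  linarith

open Metric Set in
/-- Strict form of the Schwarz lemma at the boundary: a holomorphic self-map of the disc fixing
`0` is either linear or contracts strictly near the unit circle. -/
theorem linear_or_exists_mul_le_one_sub_norm_sq {F : ℂ → ℂ}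
    (hd : DifferentiableOn ℂ F (ball 0 1)) (hm : MapsTo F (ball 0 1) (closedBall 0 1))
    (h0 : F 0 = 0) :
    (∃ l : ℂ, ∀ z ∈ ball (0 : ℂ) 1, F z = l * z) ∨
      ∃ κ > 0, ∀ z ∈ ball (0 : ℂ) 1, (1 - ‖z‖ ^ 2) * (1 + κ * ‖z‖ ^ 2) ≤ 1 - ‖F z‖ ^ 2 := by
  have hb : ball (0 : ℂ) 1 ∈ nhds 0 := ball_mem_nhds _ one_pos
  have hdd : DifferentiableOn ℂ (dslope F 0) (ball 0 1) :=
    (differentiableOn_dslope hb).mpr hd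
  have hle : ∀ z ∈ ball (0 : ℂ) 1, ‖dslope F 0 z‖ ≤ 1 := fun z hz ↦ by
    simpa using norm_dslope_le_div_of_mapsTo_ball (R₂ := 1) hd (by simpa [h0] using hm) hz
  have hF : ∀ z, F z = dslope F 0 z * z := fun z ↦ by
    have := sub_smul_dslope F 0 z
    simp only [sub_zero, h0, smul_eq_mul] at this
    rw [← this, mul_comm]
  by_cases h1 : ‖dslope F 0 0‖ < 1
  · right
    obtain ⟨κ, hκ, H⟩ := exists_mul_le_one_sub_norm_sq hdd (fun z hz ↦ by simpa using hle z hz) h1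
    refine ⟨κ, hκ, fun z hz ↦ ?_⟩
    rw [hF z, norm_mul, mul_pow]
    nlinarith [H z hz, sq_nonneg ‖z‖]
  · left
    refine ⟨dslope F 0 0, fun z hz ↦ ?_⟩
    rw [hF z]
    congr 1
    refine eqOn_of_isPreconnected_of_isMaxOn_norm (convex_ball (0 : ℂ) 1).isPreconnected isOpen_ball
      hdd (mem_ball_self one_pos) (fun w hw ↦ ?_) hz
    exact (hle w hw).trans (not_lt.mp h1)

open Metric Set Topology ComplexConjugate in
/-- A holomorphic map `g` from the right half-plane to the closed disc with `g 0 = 1` and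
`g' 0 = -2c`, `c ≤ 1`, meets the Cayley map `w ↦ (1 - w) / (1 + w)` only if the two coincide;
this is the half-plane form of the Wolff–Denjoy uniqueness of the boundary fixed point. -/
theorem ne_cayley_of_hasDerivAt_zero {g : ℂ → ℂ} {c : ℝ}
    (hg : DifferentiableOn ℂ g {w | 0 < w.re}) (hb : ∀ w : ℂ, 0 < w.re → ‖g w‖ ≤ 1)
    (hg' : HasDerivAt g (-2 * c) 0) (hg0 : g 0 = 1) (hc : c ≤ 1) (hg1 : g 1 ≠ 0)
    {w₀ : ℂ} (hw₀ : 0 < w₀.re) : g w₀ ≠ (1 - w₀) / (1 + w₀) := by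
  intro hfix
  set z₀ := (1 - w₀) / (1 + w₀) with hz₀
  have h1w : 1 + w₀ ≠ 0 := fun h ↦ by
    have := congrArg re h
    simp at this; linarith
  have hz₀lt : ‖z₀‖ < 1 := by
    rw [hz₀, norm_div, div_lt_one (norm_pos_iff.mpr h1w), ← sq_lt_sq₀ (norm_nonneg _)
      (norm_nonneg _), ← normSq_eq_norm_sq, ← normSq_eq_norm_sq]
    simp only [normSq_apply, sub_re, sub_im, add_re, add_im, one_re, one_im]
    nlinarith
  have hw₀0 : w₀ ≠ 0 := fun h ↦ by simp [h] at hw₀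
  have hadd : ∀ w : ℂ, 0 ≤ w.re → w + conj w₀ ≠ 0 := fun w hw h ↦ by
    have := congrArg re h
    simp at this; linarith
  set ψ : ℂ → ℂ := fun z ↦ (w₀ + conj w₀ * z) / (1 - z) with hψ
  set Z : ℂ → ℂ := fun w ↦ (w - w₀) / (w + conj w₀) with hZ
  have hsub : ∀ z ∈ ball (0 : ℂ) 1, 1 - z ≠ 0 := fun z hz h ↦ by
    rw [← sub_eq_zero.mp h] at hz; simp at hz
  have hψre : ∀ z ∈ ball (0 : ℂ) 1, 0 < (ψ z).re := fun z hz ↦ by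
    have h1 : normSq z < 1 := by
      rw [normSq_eq_norm_sq]
      have : ‖z‖ < 1 := by simpa using hz
      nlinarith [norm_nonneg z]
    have h2 : 0 < normSq (1 - z) := normSq_pos.mpr (hsub z hz)
    have h3 : (ψ z).re = w₀.re * (1 - normSq z) / normSq (1 - z) := by
      simp only [hψ, div_re]
      rw [← add_div]
      congr 1
      simp [normSq_apply]; ring
    rw [h3]
    exact div_pos (mul_pos hw₀ (by linarith)) h2
  have hZsq : ∀ w : ℂ, 0 ≤ w.re → 1 - ‖Z w‖ ^ 2 = 4 * w.re * w₀.re / ‖w + conj w₀‖ ^ 2 := by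
    intro w hw
    have h0 : ‖w + conj w₀‖ ^ 2 ≠ 0 := pow_ne_zero 2 (norm_ne_zero_iff.mpr (hadd w hw))
    rw [hZ, norm_div, div_pow, eq_div_iff h0, sub_mul, div_mul_cancel₀ _ h0]
    simp only [← normSq_eq_norm_sq]
    simp [normSq_apply]; ring
  have hZmem : ∀ w : ℂ, 0 < w.re → Z w ∈ ball (0 : ℂ) 1 := fun w hw ↦ by
    have h := hZsq w hw.le
    have : 0 < 4 * w.re * w₀.re / ‖w + conj w₀‖ ^ 2 :=
      div_pos (by positivity) (pow_pos (norm_pos_iff.mpr (hadd w hw.le)) 2)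
    rw [mem_ball_zero_iff]
    nlinarith [norm_nonneg (Z w)]
  have hψZ : ∀ w : ℂ, 0 < w.re → ψ (Z w) = w := fun w hw ↦ by
    have h1 := hsub _ (hZmem w hw)
    have h2 := hadd w hw.le
    simp only [hψ]
    rw [div_eq_iff h1]
    simp only [hZ]
    field_simp
    ring
  set F : ℂ → ℂ := fun z ↦ (g (ψ z) - z₀) / (1 - conj z₀ * g (ψ z)) with hF
  have hψd : DifferentiableOn ℂ ψ (ball 0 1) := by
    intro z hz
    have := hsub z hz
    exact (DifferentiableAt.div (by fun_prop) (by fun_prop) this).differentiableWithinAt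
  have hgψ : DifferentiableOn ℂ (fun z ↦ g (ψ z)) (ball 0 1) := hg.comp hψd hψre
  have hFd : DifferentiableOn ℂ F (ball 0 1) :=
    (hgψ.sub_const _).div ((hgψ.const_mul _).const_sub _)
      fun z hz ↦ one_sub_conj_mul_ne_zero hz₀lt (hb _ (hψre z hz))
  have hFm : MapsTo F (ball 0 1) (closedBall 0 1) := fun z hz ↦
    mem_closedBall_zero_iff.mpr (norm_moebius_le_one hz₀lt (hb _ (hψre z hz)))
  have hF0 : F 0 = 0 := by simp [hF, hψ, hfix]
  have hz₀1 : 1 - conj z₀ ≠ 0 := by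
    simpa using one_sub_conj_mul_ne_zero (ζ := 1) hz₀lt (by simp)
  have hreal : Tendsto (fun x : ℝ ↦ (x : ℂ)) (𝓝[>] 0) (𝓝 0) :=
    (continuous_ofReal.tendsto' 0 0 (by simp)).mono_left nhdsWithin_le_nhds
  have hglim : Tendsto (fun x : ℝ ↦ g x) (𝓝[>] 0) (𝓝 1) := by
    have := hg'.continuousAt.tendsto.comp hreal
    rwa [hg0] at this
  have hcw₀ : conj w₀ ≠ 0 := by simpa using hw₀0
  have hZlim : Tendsto (fun x : ℝ ↦ Z x) (𝓝[>] 0) (𝓝 (-w₀ / conj w₀)) := by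
    have : Tendsto (fun x : ℝ ↦ Z x) (𝓝[>] 0) (𝓝 ((0 - w₀) / (0 + conj w₀))) :=
      (hreal.sub_const _).div (hreal.add_const _) (by simpa using hw₀0)
    simpa using this
  rcases linear_or_exists_mul_le_one_sub_norm_sq hFd hFm hF0 with ⟨l, hl⟩ | ⟨κ, hκ, H⟩
  · have key : ∀ w : ℂ, 0 < w.re → (g w - z₀) / (1 - conj z₀ * g w) = l * Z w := fun w hw ↦ by
      rw [← hl _ (hZmem w hw)]
      simp only [hF, hψZ w hw]
    have hL : Tendsto (fun x : ℝ ↦ (g x - z₀) / (1 - conj z₀ * g x)) (𝓝[>] 0)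
        (𝓝 ((1 - z₀) / (1 - conj z₀ * 1))) :=
      (hglim.sub_const _).div ((hglim.const_mul _).const_sub _) (by simpa using hz₀1)
    have hR : Tendsto (fun x : ℝ ↦ l * Z x) (𝓝[>] 0) (𝓝 (l * (-w₀ / conj w₀))) :=
      hZlim.const_mul _
    have hlim := tendsto_nhds_unique (hL.congr' (by
      filter_upwards [self_mem_nhdsWithin] with x hx
      exact key x (by simpa using hx))) hR
    have h1cw : 1 + conj w₀ ≠ 0 := hadd 1 (by simp)
    have hcz : conj z₀ = (1 - conj w₀) / (1 + conj w₀) := by simp [hz₀]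
    have hl' : l = -(1 + conj w₀) / (1 + w₀) := by
      have e1 : 1 - z₀ = 2 * w₀ / (1 + w₀) := by rw [hz₀]; field_simp; ring
      have e2 : 1 - conj z₀ = 2 * conj w₀ / (1 + conj w₀) := by rw [hcz]; field_simp; ring
      rw [mul_one, e1, e2] at hlim
      field_simp at hlim
      rw [eq_div_iff h1w]
      linear_combination hlim
    have h1 := key 1 (by simp)
    have hd1 := one_sub_conj_mul_ne_zero hz₀lt (hb 1 (by simp))
    have hr : l * Z 1 = -z₀ := by
      rw [hl', hZ, hz₀]; field_simp
    rw [hr, div_eq_iff hd1] at h1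
    have h2 : g 1 * (1 - z₀ * conj z₀) = 0 := by linear_combination h1
    rcases mul_eq_zero.mp h2 with h | h
    · exact hg1 h
    · rw [mul_conj, normSq_eq_norm_sq] at h
      have : ‖z₀‖ ^ 2 = 1 := by
        have := sub_eq_zero.mp h
        exact_mod_cast this.symm
      nlinarith [norm_nonneg z₀]
  · have hsq : Tendsto (fun x : ℝ ↦ (1 - ‖g x‖ ^ 2) / x) (𝓝[>] 0) (𝓝 (4 * c)) := by
      have hd : HasDerivAt (fun x : ℝ ↦ ‖g x‖ ^ 2) (2 * inner ℝ (g (0 : ℝ)) (-2 * c)) 0 :=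
        HasDerivAt.norm_sq (HasDerivAt.comp_ofReal (by simpa using hg'))
      have := (hasDerivAt_iff_tendsto_slope.mp hd).mono_left
        (nhdsWithin_mono 0 (fun x (hx : 0 < x) ↦ (ne_of_gt hx : x ≠ 0)))
      have h2 := this.neg
      have e : -(2 * inner ℝ (g (0 : ℝ)) (-2 * c : ℂ)) = 4 * c := by
        rw [ofReal_zero, hg0]
        simp [Complex.inner]
        ring
      rw [e] at h2
      refine h2.congr fun x ↦ ?_
      simp [slope_def_field, hg0]
      ring
    have hineq : ∀ᶠ x : ℝ in 𝓝[>] 0, 4 * w₀.re / ‖(x : ℂ) + conj w₀‖ ^ 2 * (1 + κ * ‖Z x‖ ^ 2) ≤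
        (1 - ‖z₀‖ ^ 2) * ((1 - ‖g x‖ ^ 2) / x) / ‖1 - conj z₀ * g x‖ ^ 2 := by
      filter_upwards [self_mem_nhdsWithin] with x hx
      have hx : 0 < x := hx
      have hxre : 0 < (x : ℂ).re := by simpa using hx
      have h := H _ (hZmem x hxre)
      rw [hZsq x hxre.le] at h
      simp only [hF, hψZ x hxre] at h
      rw [one_sub_norm_sq_moebius hz₀lt (hb _ hxre)] at h
      have h' := div_le_div_of_nonneg_right h hx.le
      calc _ = 4 * (x : ℂ).re * w₀.re / ‖(x : ℂ) + conj w₀‖ ^ 2 * (1 + κ * ‖Z x‖ ^ 2) / x := by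
            rw [ofReal_re]; field_simp
        _ ≤ _ := h'
        _ = _ := by ring
    have hA : Tendsto (fun x : ℝ ↦ 4 * w₀.re / ‖(x : ℂ) + conj w₀‖ ^ 2 * (1 + κ * ‖Z x‖ ^ 2))
        (𝓝[>] 0) (𝓝 (4 * w₀.re / ‖0 + conj w₀‖ ^ 2 * (1 + κ * ‖-w₀ / conj w₀‖ ^ 2))) := by
      refine (Tendsto.div tendsto_const_nhds ((hreal.add_const _).norm.pow 2) ?_).mul
        (((hZlim.norm.pow 2).const_mul κ).const_add 1)
      simpa using hw₀0
    have hB : Tendsto (fun x : ℝ ↦ (1 - ‖z₀‖ ^ 2) * ((1 - ‖g x‖ ^ 2) / x) /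
        ‖1 - conj z₀ * g x‖ ^ 2) (𝓝[>] 0)
        (𝓝 ((1 - ‖z₀‖ ^ 2) * (4 * c) / ‖1 - conj z₀ * 1‖ ^ 2)) := by
      refine (hsq.const_mul _).div (((hglim.const_mul _).const_sub _).norm.pow 2) ?_
      simpa using hz₀1
    have hfin := le_of_tendsto_of_tendsto hA hB hineq
    have hnw : 0 < ‖w₀‖ := norm_pos_iff.mpr hw₀0
    have e1 : ‖-w₀ / conj w₀‖ = 1 := by simp [hnw.ne']
    have e2 : ‖1 - conj z₀ * 1‖ = ‖1 - z₀‖ := by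
      rw [mul_one, ← RCLike.norm_conj (1 - z₀)]; simp
    have e3 : (1 - ‖z₀‖ ^ 2) / ‖1 - z₀‖ ^ 2 = w₀.re / ‖w₀‖ ^ 2 := by
      have f1 : 1 - z₀ = 2 * w₀ / (1 + w₀) := by rw [hz₀]; field_simp; ring
      have hn1 : 0 < ‖1 + w₀‖ := norm_pos_iff.mpr h1w
      have f2 : 1 - ‖z₀‖ ^ 2 = 4 * w₀.re / ‖1 + w₀‖ ^ 2 := by
        have h0 : ‖1 + w₀‖ ^ 2 ≠ 0 := by positivity
        rw [hz₀, norm_div, div_pow, eq_div_iff h0, sub_mul, div_mul_cancel₀ _ h0]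
        simp only [← normSq_eq_norm_sq]
        simp [normSq_apply]; ring
      rw [f1, f2, norm_div, norm_mul, RCLike.norm_ofNat]
      field_simp
      norm_num
    rw [e1, e2, zero_add, RCLike.norm_conj] at hfin
    have e4 : (1 - ‖z₀‖ ^ 2) * (4 * c) / ‖1 - z₀‖ ^ 2 = 4 * w₀.re / ‖w₀‖ ^ 2 * c := by
      rw [mul_div_right_comm, e3]; ring
    rw [e4] at hfin
    have hpos : 0 < 4 * w₀.re / ‖w₀‖ ^ 2 := by positivity
    have := le_of_mul_le_mul_left hfin hpos
    linarith

/-- Sieving a completely multiplicative summable function on ideals by finitely many primes. -/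
theorem tsum_sieve_eq_mul_prod {R : Type*} [CommRing R] [IsDedekindDomain R]
    {𝕜 : Type*} [NormedField 𝕜] [CompleteSpace 𝕜] (f : Ideal R →*₀ 𝕜)
    (hf : Summable fun I ↦ ‖f I‖) (S : Finset (Ideal R)) (hS : ∀ P ∈ S, Prime P) :
    ∑' I, {I : Ideal R | ∀ P ∈ S, ¬ P ∣ I}.indicator f I = (∑' I, f I) * ∏ P ∈ S, (1 - f P) := by
  classical
  induction S using Finset.induction_on with
  | empty => simp
  | insert P S hPS ih =>
    have hP : Prime P := hS P (Finset.mem_insert_self _ _)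
    have hS' : ∀ Q ∈ S, Prime Q := fun Q hQ ↦ hS Q (Finset.mem_insert_of_mem hQ)
    have hs : ∀ A : Set (Ideal R), Summable (A.indicator f) := fun A ↦ hf.of_norm.indicator A
    have hinj : Function.Injective fun J : Ideal R ↦ P * J := mul_right_injective₀ hP.ne_zero
    have hcop : ∀ J : Ideal R, (∀ Q ∈ S, ¬ Q ∣ P * J) ↔ ∀ Q ∈ S, ¬ Q ∣ J := fun J ↦ by
      refine forall₂_congr fun Q hQ ↦ not_congr ⟨fun h ↦ ?_, fun h ↦ h.mul_left P⟩
      refine ((hS' Q hQ).dvd_or_dvd h).resolve_left fun h' ↦ hPS ?_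
      rw [← associated_iff_eq.mp ((hS' Q hQ).associated_of_dvd hP h')]
      exact hQ
    have hmul : ∑' I, {I : Ideal R | (∀ Q ∈ S, ¬ Q ∣ I) ∧ P ∣ I}.indicator f I =
        f P * ∑' I, {I : Ideal R | ∀ Q ∈ S, ¬ Q ∣ I}.indicator f I := by
      rw [← tsum_mul_left, ← hinj.tsum_eq]
      · refine tsum_congr fun J ↦ ?_
        simp only [Set.indicator_apply, Set.mem_ofPred_eq, hcop, dvd_mul_right, and_true, map_mul,
          mul_ite, mul_zero]
      · intro I hI
        obtain ⟨J, rfl⟩ := (Set.mem_of_indicator_ne_zero hI).2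
        exact ⟨J, rfl⟩
    rw [Finset.prod_insert hPS, mul_left_comm, ← ih hS', sub_mul, one_mul, ← hmul,
      ← (hs _).tsum_sub (hs _)]
    refine tsum_congr fun I ↦ ?_
    simp only [Set.indicator_apply, Set.mem_ofPred_eq, Finset.forall_mem_insert]
    by_cases h1 : ∀ Q ∈ S, ¬ Q ∣ I <;> by_cases h2 : P ∣ I <;> simp [h1, h2]

/-- Euler-product lower bound for the sum of a completely multiplicative function on ideals. -/
theorem half_le_norm_tsum_mul_tsum_norm {R : Type*} [CommRing R] [IsDedekindDomain R]
    (f : Ideal R →*₀ ℂ) (hf : Summable fun I ↦ ‖f I‖) (hf1 : ∀ I, ‖f I‖ ≤ 1) :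
    1 / 2 ≤ ‖∑' I, f I‖ * ∑' I, ‖f I‖ := by
  classical
  obtain ⟨T, hT⟩ : ∃ T : Finset (Ideal R), ∑' I : {I // I ∉ T}, ‖f I‖ < 1 / 2 :=
    ((tendsto_tsum_compl_atTop_zero fun I ↦ ‖f I‖).eventually (gt_mem_nhds (by norm_num))).exists
  have hex : ∀ I : Ideal R, I ≠ 0 → I ≠ 1 → ∃ P : Ideal R, Prime P ∧ P ∣ I := fun I h0 h1 ↦ by
    obtain ⟨M, hM, hIM⟩ := Ideal.exists_le_maximal I (by rwa [← Ideal.one_eq_top])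
    refine ⟨M, Ideal.prime_of_isPrime (fun hM0 ↦ h0 ?_) hM.isPrime, Ideal.dvd_iff_le.mpr hIM⟩
    exact le_bot_iff.mp (hM0 ▸ hIM)
  choose! p hp hpd using hex
  set S := (T.filter fun I ↦ I ≠ 0 ∧ I ≠ 1).image p with hSdef
  have hS : ∀ P ∈ S, Prime P := fun P hP ↦ by
    obtain ⟨I, hI, rfl⟩ := Finset.mem_image.mp hP
    exact hp I (Finset.mem_filter.mp hI).2.1 (Finset.mem_filter.mp hI).2.2
  set U := {I : Ideal R | ∀ P ∈ S, ¬ P ∣ I} with hU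
  have h1U : (1 : Ideal R) ∈ U := fun P hP h ↦ (hS P hP).not_isUnit (isUnit_of_dvd_one h)
  have hUT : ∀ I ∈ U, I ≠ 0 → I ≠ 1 → I ∉ T := fun I hI h0 h1 hIT ↦
    hI (p I) (Finset.mem_image_of_mem p (Finset.mem_filter.mpr ⟨hIT, h0, h1⟩)) (hpd I h0 h1)
  set g : Ideal R →*₀ ℝ := (normHom : ℂ →*₀ ℝ).comp f with hg
  have hgf : ∀ I, g I = ‖f I‖ := fun I ↦ rfl
  have hg0 : ∀ I, 0 ≤ g I := fun I ↦ (hgf I).symm ▸ norm_nonneg (f I)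
  have hgs : Summable fun I ↦ ‖g I‖ := by simpa [hgf] using hf
  have key := tsum_sieve_eq_mul_prod f hf S hS
  have keyg := tsum_sieve_eq_mul_prod g hgs S hS
  have hA : 1 / 2 ≤ ‖∑' I, U.indicator f I‖ := by
    have hsplit : ∑' I, U.indicator f I = 1 + ∑' I, (U \ {1}).indicator f I := by
      rw [(hf.of_norm.indicator U).tsum_eq_add_tsum_ite 1]
      congr 1
      · rw [Set.indicator_of_mem h1U, map_one]
      · refine tsum_congr fun I ↦ ?_
        by_cases h : I = 1 <;> simp [Set.indicator_apply, h, -Ideal.one_eq_top]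
    have hle : ‖∑' I, (U \ {1}).indicator f I‖ ≤ 1 / 2 := by
      refine le_trans (tsum_of_norm_bounded (g := (↑T : Set (Ideal R))ᶜ.indicator fun I ↦ ‖f I‖)
        (hf.indicator _).hasSum fun I ↦ ?_) ?_
      · by_cases hI : I ∈ U \ {1}
        · rw [Set.indicator_of_mem hI]
          by_cases h0 : I = 0
          · rw [h0]; simp only [map_zero, norm_zero]
            exact Set.indicator_nonneg (fun _ _ ↦ norm_nonneg _) _
          · rw [Set.indicator_of_mem]
            simpa using hUT I hI.1 h0 (by simpa using hI.2)
        · rw [Set.indicator_of_notMem hI, norm_zero]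
          exact Set.indicator_nonneg (fun _ _ ↦ norm_nonneg _) _
      · rw [← tsum_subtype]
        exact hT.le
    rw [hsplit]
    have := norm_sub_le_norm_add (1 : ℂ) (∑' I, (U \ {1}).indicator f I)
    rw [norm_one] at this
    linarith
  have hB : 1 ≤ ∑' I, U.indicator g I := by
    have := (hgs.of_norm.indicator U).le_tsum 1
      fun I _ ↦ Set.indicator_nonneg (fun I _ ↦ hg0 I) _
    rwa [Set.indicator_of_mem h1U, map_one] at this
  rw [key, norm_mul, norm_prod] at hA
  rw [keyg] at hB
  have hx0 : ∀ P ∈ S, 0 ≤ 1 + ‖f P‖ := fun P _ ↦ by positivity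
  have hprod : ∏ P ∈ S, ‖1 - f P‖ ≤ ∏ P ∈ S, (1 + ‖f P‖) :=
    Finset.prod_le_prod (fun _ _ ↦ norm_nonneg _) fun P _ ↦ by
      simpa using norm_sub_le (1 : ℂ) (f P)
  have hprod1 : (∏ P ∈ S, (1 - g P)) * ∏ P ∈ S, (1 + ‖f P‖) ≤ 1 := by
    rw [← Finset.prod_mul_distrib]
    refine Finset.prod_le_one (fun P _ ↦ ?_) fun P _ ↦ ?_ <;> rw [hgf] <;>
      nlinarith [hf1 P, norm_nonneg (f P)]
  have hQ0 : 0 ≤ ∏ P ∈ S, (1 + ‖f P‖) := Finset.prod_nonneg hx0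
  have hG0 : 0 ≤ ∑' I, g I := tsum_nonneg hg0
  have hQ : ∏ P ∈ S, (1 + ‖f P‖) ≤ ∑' I, g I := by
    nlinarith [mul_le_mul_of_nonneg_left hprod1 hG0, mul_le_mul_of_nonneg_right hB hQ0]
  calc 1 / 2 ≤ _ := hA
    _ ≤ ‖∑' I, f I‖ * ∏ P ∈ S, (1 + ‖f P‖) := by gcongr
    _ ≤ _ := by
      have : ∑' I, ‖f I‖ = ∑' I, g I := rfl
      rw [this]; gcongr

/-- A shifted one-dimensional Gaussian sum is asymptotic to its integral, by Poisson summation. -/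
theorem exists_abs_tsum_exp_sub_le : ∃ c : ℝ, 0 ≤ c ∧ ∀ a : ℝ, 0 < a → ∀ u : ℝ,
    |∑' n : ℤ, Real.exp (-Real.pi * a * (n + u) ^ 2) - 1 / a ^ (1 / 2 : ℝ)| ≤
      1 / a ^ (1 / 2 : ℝ) * (c * a) := by
  refine ⟨∑' n : ℤ, 1 / (n : ℝ) ^ 2 / Real.pi, tsum_nonneg fun n ↦ by positivity, fun a ha u ↦ ?_⟩
  have hpi := Real.pi_pos
  have hac : (a : ℂ) ≠ 0 := ofReal_ne_zero.mpr ha.ne'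
  have hP := Complex.tsum_exp_neg_quadratic (a := a) (by simpa using ha) (-a * u)
  have h1 : ((∑' n : ℤ, Real.exp (-Real.pi * a * (n + u) ^ 2) : ℝ) : ℂ) =
      1 / (a : ℂ) ^ (1 / 2 : ℂ) * ∑' n : ℤ, cexp (-Real.pi / a * n ^ 2 + 2 * Real.pi * u * n * I) := by
    have e1 : ((∑' n : ℤ, Real.exp (-Real.pi * a * (n + u) ^ 2) : ℝ) : ℂ) =
        cexp (-Real.pi * a * u ^ 2) *
          ∑' n : ℤ, cexp (-Real.pi * a * n ^ 2 + 2 * Real.pi * (-a * u) * n) := by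
      rw [ofReal_tsum, ← tsum_mul_left]
      refine tsum_congr fun n ↦ ?_
      rw [← Complex.exp_add]
      push_cast
      congr 1
      ring
    rw [e1, hP, mul_left_comm, ← tsum_mul_left]
    congr 1
    refine tsum_congr fun n ↦ ?_
    rw [← Complex.exp_add]
    congr 1
    field_simp
    ring_nf
    simp only [I_sq]
    ring
  have hs : Summable fun n : ℤ ↦ 1 / (n : ℝ) ^ 2 / Real.pi * a :=
    ((Real.summable_one_div_int_pow.mpr one_lt_two).div_const _).mul_right _
  set v : ℤ → ℂ := fun n ↦ cexp (-Real.pi / a * n ^ 2 + 2 * Real.pi * u * n * I) with hv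
  have hvn : ∀ n : ℤ, n ≠ 0 → ‖v n‖ ≤ 1 / (n : ℝ) ^ 2 / Real.pi * a := fun n hn ↦ by
    have hn2 : 0 < (n : ℝ) ^ 2 := by positivity
    have hre : (-(Real.pi : ℂ) / a * n ^ 2 + 2 * Real.pi * u * n * I).re =
        -(Real.pi * n ^ 2 / a) := by
      have : (-(Real.pi : ℂ) / a * n ^ 2 + 2 * Real.pi * u * n * I) =
        ((-(Real.pi * n ^ 2 / a) : ℝ) : ℂ) + ((2 * Real.pi * u * n : ℝ) : ℂ) * I := by
        push_cast; ring
      rw [this, add_re, ofReal_re, re_ofReal_mul, I_re, mul_zero, add_zero]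
    rw [hv, Complex.norm_exp, hre, Real.exp_neg]
    have h2 : 0 < Real.pi * n ^ 2 / a := by positivity
    calc (Real.exp (Real.pi * n ^ 2 / a))⁻¹ ≤ (Real.pi * n ^ 2 / a)⁻¹ := by
          gcongr
          linarith [Real.add_one_le_exp (Real.pi * n ^ 2 / a)]
      _ = _ := by field_simp
  have hvs : Summable v := by
    refine Summable.of_norm_bounded_eventually hs ?_
    filter_upwards [(Set.finite_singleton (0 : ℤ)).compl_mem_cofinite] with n hn using hvn n hn
  have hb : ‖∑' n, v n - 1‖ ≤ (∑' n : ℤ, 1 / (n : ℝ) ^ 2 / Real.pi) * a := by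
    rw [hvs.tsum_eq_add_tsum_ite 0, ← tsum_mul_right]
    have : v 0 = 1 := by simp [hv]
    rw [this, add_sub_cancel_left]
    refine tsum_of_norm_bounded hs.hasSum fun n ↦ ?_
    split_ifs with h
    · simp [h]
    · exact hvn n h
  have hcp : (a : ℂ) ^ (1 / 2 : ℂ) = ((a ^ (1 / 2 : ℝ) : ℝ) : ℂ) := by
    rw [ofReal_cpow ha.le]; norm_num
  have hpos : 0 < 1 / a ^ (1 / 2 : ℝ) := by positivity
  rw [← Real.norm_eq_abs, ← Complex.norm_real, ofReal_sub, h1, hcp]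
  calc _ = ‖((1 / a ^ (1 / 2 : ℝ) : ℝ) : ℂ) * (∑' n, v n - 1)‖ := by
        congr 1; push_cast; ring
    _ ≤ _ := by
      rw [norm_mul, Complex.norm_real, Real.norm_eq_abs, abs_of_pos hpos]
      gcongr

theorem summable_exp_neg_pi_mul_int_sq {a : ℝ} (ha : 0 < a) :
    Summable fun n : ℤ ↦ Real.exp (-Real.pi * a * n ^ 2) := by
  refine Summable.of_norm_bounded_eventually
    (((Real.summable_one_div_int_pow.mpr one_lt_two).div_const Real.pi).div_const a) ?_
  filter_upwards [(Set.finite_singleton (0 : ℤ)).compl_mem_cofinite] with n hn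
  have hn : n ≠ 0 := hn
  have hpi := Real.pi_pos
  have h2 : 0 < Real.pi * a * n ^ 2 := by positivity
  rw [Real.norm_of_nonneg (Real.exp_nonneg _), neg_mul, neg_mul, Real.exp_neg]
  calc (Real.exp (Real.pi * a * n ^ 2))⁻¹ ≤ (Real.pi * a * n ^ 2)⁻¹ := by
        gcongr
        linarith [Real.add_one_le_exp (Real.pi * a * n ^ 2)]
    _ = _ := by field_simp

/-- The binary quadratic form `A |m z + n|²` attached to a lattice in `ℂ`. -/
noncomputable def latticeForm (z : UpperHalfPlane) (A : ℝ) (x : Fin 2 → ℤ) : ℝ :=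
  A * ‖(x 0 : ℂ) * z + x 1‖ ^ 2

theorem latticeForm_zero (z : UpperHalfPlane) (A : ℝ) : latticeForm z A 0 = 0 := by
  simp [latticeForm]

theorem latticeForm_pos (z : UpperHalfPlane) {A : ℝ} (hA : 0 < A) {x : Fin 2 → ℤ} (hx : x ≠ 0) :
    0 < latticeForm z A x := by
  refine mul_pos hA (pow_pos (norm_pos_iff.mpr fun h ↦ hx ?_) 2)
  have h0 := congrArg im h
  have h1 := congrArg re h
  simp [z.im_pos.ne'] at h0 h1
  ext i; fin_cases i
  · exact h0
  · simpa [h0] using h1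

theorem latticeForm_nonneg (z : UpperHalfPlane) {A : ℝ} (hA : 0 < A) (x : Fin 2 → ℤ) :
    0 ≤ latticeForm z A x := by
  unfold latticeForm; positivity

theorem latticeForm_eq (z : UpperHalfPlane) (A : ℝ) (x : Fin 2 → ℤ) :
    latticeForm z A x = A * (x 1 + x 0 * z.re) ^ 2 + A * z.im ^ 2 * x 0 ^ 2 := by
  unfold latticeForm
  rw [← normSq_eq_norm_sq, normSq_apply]
  simp
  ring

theorem summable_latticeForm_rpow (z : UpperHalfPlane) {A : ℝ} (hA : 0 < A) {σ : ℝ} (hσ : 1 < σ) :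
    Summable fun x : Fin 2 → ℤ ↦ latticeForm z A x ^ (-σ) := by
  have hs := (EisensteinSeries.summable_one_div_norm_rpow (k := 2 * σ) (by linarith)).mul_left
    (A ^ (-σ) * EisensteinSeries.r z ^ (-(2 * σ)))
  refine hs.of_nonneg_of_le (fun x ↦ Real.rpow_nonneg (latticeForm_nonneg z hA x) _) fun x ↦ ?_
  unfold latticeForm
  rw [Real.mul_rpow hA.le (by positivity), mul_assoc, ← Real.rpow_natCast, ← Real.rpow_mul
    (norm_nonneg _)]
  gcongr
  have := EisensteinSeries.summand_bound z (k := 2 * σ) (by linarith) x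
  simpa using this

theorem exp_neg_latticeForm_le (z : UpperHalfPlane) {A : ℝ} (hA : 0 < A) {t : ℝ} (ht : 0 < t)
    {x : Fin 2 → ℤ} (hx : x ≠ 0) :
    Real.exp (-Real.pi * latticeForm z A x * t) ≤ t ^ (-3 : ℝ) * latticeForm z A x ^ (-3 : ℝ) := by
  have hQ := latticeForm_pos z hA hx
  set Q := latticeForm z A x
  have h1 := Real.pow_div_factorial_le_exp (Real.pi * Q * t) (by positivity) 3
  have hpi : (6 : ℝ) ≤ Real.pi ^ 3 := by
    have := pow_le_pow_left₀ (by norm_num) Real.pi_gt_three.le 3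
    linarith
  have h2 : (Q * t) ^ 3 ≤ Real.exp (Real.pi * Q * t) := by
    refine le_trans ?_ h1
    rw [le_div_iff₀ (by positivity), mul_assoc, mul_pow Real.pi, mul_comm]
    norm_num [Nat.factorial]
    gcongr
  have e : -Real.pi * Q * t = -(Real.pi * Q * t) := by ring
  rw [e, Real.exp_neg, ← Real.mul_rpow ht.le hQ.le, Real.rpow_neg (by positivity)]
  refine inv_anti₀ (by positivity) ?_
  rw [mul_comm t]
  exact_mod_cast h2

theorem summable_exp_neg_latticeForm (z : UpperHalfPlane) {A : ℝ} (hA : 0 < A) {t : ℝ}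
    (ht : 0 < t) : Summable fun x : Fin 2 → ℤ ↦ Real.exp (-Real.pi * latticeForm z A x * t) := by
  refine Summable.of_norm_bounded_eventually
    ((summable_latticeForm_rpow z hA (σ := 3) (by norm_num)).mul_left (t ^ (-3 : ℝ))) ?_
  filter_upwards [(Set.finite_singleton (0 : Fin 2 → ℤ)).compl_mem_cofinite] with x hx
  rw [Real.norm_of_nonneg (Real.exp_nonneg _)]
  exact exp_neg_latticeForm_le z hA ht hx

/-- The two-dimensional theta function of a lattice form differs from `1 / (A y t)` by a bounded
amount as `t → 0⁺`. -/
theorem exists_abs_theta_sub_le (z : UpperHalfPlane) {A : ℝ} (hA : 0 < A) :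
    ∃ C : ℝ, ∀ t ∈ Set.Ioc (0 : ℝ) 1,
      |∑' x : Fin 2 → ℤ, Real.exp (-Real.pi * latticeForm z A x * t) - 1 / (A * z.im) / t| ≤ C := by
  obtain ⟨c, hc, H⟩ := exists_abs_tsum_exp_sub_le
  have hy := z.im_pos
  refine ⟨1 / (A * z.im) * (c * A * z.im ^ 2 + c * A * (1 + c * A * z.im ^ 2)), fun t ht ↦ ?_⟩
  have ht0 : 0 < t := ht.1
  set a := A * t with ha
  set b := A * z.im ^ 2 * t with hb
  have ha0 : 0 < a := by positivity
  have hb0 : 0 < b := by positivity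
  have hw := summable_exp_neg_pi_mul_int_sq hb0
  have hsum := summable_exp_neg_latticeForm z hA ht0
  rw [← (finTwoArrowEquiv ℤ).symm.summable_iff] at hsum
  have hterm : ∀ p : ℤ × ℤ, Real.exp (-Real.pi * latticeForm z A ((finTwoArrowEquiv ℤ).symm p) * t)
      = Real.exp (-Real.pi * b * p.1 ^ 2) * Real.exp (-Real.pi * a * (p.2 + p.1 * z.re) ^ 2) := by
    intro p
    rw [latticeForm_eq, ← Real.exp_add]
    congr 1
    simp [ha, hb]
    ring
  have e1 : ∑' x : Fin 2 → ℤ, Real.exp (-Real.pi * latticeForm z A x * t) =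
      ∑' m : ℤ, Real.exp (-Real.pi * b * m ^ 2) *
        ∑' n : ℤ, Real.exp (-Real.pi * a * (n + m * z.re) ^ 2) := by
    rw [← (finTwoArrowEquiv ℤ).symm.tsum_eq]
    simp only [Function.comp_def, hterm] at hsum ⊢
    rw [hsum.tsum_prod]
    simp only [tsum_mul_left]
  have hsum2 : Summable fun m : ℤ ↦ Real.exp (-Real.pi * b * m ^ 2) *
        ∑' n : ℤ, Real.exp (-Real.pi * a * (n + m * z.re) ^ 2) := by
    simp only [Function.comp_def, hterm] at hsum
    simpa only [tsum_mul_left] using hsum.prod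
  set α := 1 / a ^ (1 / 2 : ℝ) with hα
  set β := 1 / b ^ (1 / 2 : ℝ) with hβ
  have hα0 : 0 < α := by positivity
  have hβ0 : 0 < β := by positivity
  have hαβ : α * β = 1 / (A * z.im) / t := by
    rw [hα, hβ, one_div_mul_one_div, ← Real.mul_rpow ha0.le hb0.le, ← Real.sqrt_eq_rpow,
      show a * b = (A * z.im * t) ^ 2 by rw [ha, hb]; ring, Real.sqrt_sq (by positivity), one_div,
      one_div, mul_inv _ t, div_eq_mul_inv]
  set W := ∑' m : ℤ, Real.exp (-Real.pi * b * m ^ 2) with hW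
  have hW1 : |W - β| ≤ β * (c * b) := by
    have := H b hb0 0
    simp only [add_zero] at this
    exact this
  have hstep : |∑' m : ℤ, Real.exp (-Real.pi * b * m ^ 2) *
        ∑' n : ℤ, Real.exp (-Real.pi * a * (n + m * z.re) ^ 2) - W * α| ≤ W * (α * (c * a)) := by
    rw [hW, ← tsum_mul_right, ← tsum_mul_right, ← hsum2.tsum_sub (hw.mul_right _),
      ← Real.norm_eq_abs]
    refine tsum_of_norm_bounded (hw.mul_right _).hasSum fun m ↦ ?_
    rw [← mul_sub, norm_mul, Real.norm_of_nonneg (Real.exp_nonneg _), Real.norm_eq_abs]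
    exact mul_le_mul_of_nonneg_left (H a ha0 _) (Real.exp_nonneg _)
  have hWle : W ≤ β * (1 + c * b) := by linarith [(abs_le.mp hW1).2]
  rw [e1, ← hαβ]
  set T := ∑' m : ℤ, Real.exp (-Real.pi * b * m ^ 2) *
        ∑' n : ℤ, Real.exp (-Real.pi * a * (n + m * z.re) ^ 2)
  have hbt : b ≤ A * z.im ^ 2 := mul_le_of_le_one_right (by positivity) ht.2
  calc |T - α * β| ≤ |T - W * α| + |W - β| * α := by
        rw [← abs_of_pos hα0, ← abs_mul, abs_of_pos hα0]
        convert! abs_add_le (T - W * α) ((W - β) * α) using 2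
        ring
    _ ≤ W * (α * (c * a)) + β * (c * b) * α := by gcongr
    _ ≤ β * (1 + c * b) * (α * (c * a)) + β * (c * b) * α := by gcongr
    _ = α * β * (c * b + c * a * (1 + c * b)) := by ring
    _ = 1 / (A * z.im) * (c * A * z.im ^ 2 + c * A * (1 + c * b)) := by
      rw [hαβ, ha, hb]; field_simp
    _ ≤ _ := by
      rw [mul_assoc c A (z.im ^ 2)]
      gcongr

theorem continuousOn_tsum_exp_neg_latticeForm (z : UpperHalfPlane) {A : ℝ} (hA : 0 < A) :
    ContinuousOn (fun t : ℝ ↦ ∑' x : Fin 2 → ℤ, Real.exp (-Real.pi * latticeForm z A x * t))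
      (Set.Ioi 0) := by
  intro t ht
  have ht0 : (0 : ℝ) < t / 2 := half_pos ht
  have hc : ContinuousOn
      (fun t : ℝ ↦ ∑' x : Fin 2 → ℤ, Real.exp (-Real.pi * latticeForm z A x * t))
      (Set.Ici (t / 2)) := by
    refine continuousOn_tsum (fun x ↦ by fun_prop) (summable_exp_neg_latticeForm z hA ht0)
      fun x u hu ↦ ?_
    rw [Real.norm_of_nonneg (Real.exp_nonneg _), Real.exp_le_exp]
    have := mul_nonneg Real.pi_pos.le (latticeForm_nonneg z hA x)
    nlinarith [mul_le_mul_of_nonneg_left (Set.mem_Ici.mp hu) this]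
  exact (hc.continuousAt (Ici_mem_nhds (half_lt_self ht))).continuousWithinAt

theorem tsum_exp_neg_latticeForm_sub_one (z : UpperHalfPlane) {A : ℝ} (hA : 0 < A) {t : ℝ}
    (ht : 0 < t) : HasSum (fun x : Fin 2 → ℤ ↦ if x = 0 then 0 else
      Real.exp (-Real.pi * latticeForm z A x * t))
      (∑' x : Fin 2 → ℤ, Real.exp (-Real.pi * latticeForm z A x * t) - 1) := by
  have h := (summable_exp_neg_latticeForm z hA ht).hasSum.sub (hasSum_ite_eq (0 : Fin 2 → ℤ) (1:ℝ))
  convert! h using 2 with x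
  split_ifs with hx
  · simp [hx, latticeForm_zero]
  · simp

theorem exists_abs_theta_sub_one_le (z : UpperHalfPlane) {A : ℝ} (hA : 0 < A) :
    ∃ M : ℝ, ∀ t : ℝ, 0 < t →
      |∑' x : Fin 2 → ℤ, Real.exp (-Real.pi * latticeForm z A x * t) - 1| ≤ M * t ^ (-3 : ℝ) := by
  refine ⟨∑' x, latticeForm z A x ^ (-3 : ℝ), fun t ht ↦ ?_⟩
  have hs := summable_latticeForm_rpow z hA (σ := 3) (by norm_num)
  rw [← (tsum_exp_neg_latticeForm_sub_one z hA ht).tsum_eq, ← Real.norm_eq_abs]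
  refine tsum_of_norm_bounded (hs.hasSum.mul_right _) fun x ↦ ?_
  have := Real.rpow_nonneg (latticeForm_nonneg z hA x) (-3)
  split_ifs with hx
  · rw [norm_zero]; exact mul_nonneg this (by positivity)
  · rw [Real.norm_of_nonneg (Real.exp_nonneg _), mul_comm (latticeForm z A x ^ _)]
    exact exp_neg_latticeForm_le z hA ht hx

theorem locallyIntegrableOn_indicator_cpow_neg_one :
    MeasureTheory.LocallyIntegrableOn
      (Set.indicator (Set.Ioc 0 1) (fun t : ℝ ↦ (t : ℂ) ^ (-1 : ℂ))) (Set.Ioi 0) := by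
  refine (MeasureTheory.locallyIntegrableOn_iff (isOpen_Ioi.isLocallyClosed)).mpr fun k hk hc ↦ ?_
  refine MeasureTheory.Integrable.indicator ?_ measurableSet_Ioc
  refine ContinuousOn.integrableOn_compact hc fun t ht ↦ ?_
  refine ContinuousAt.continuousWithinAt ?_
  exact continuousAt_ofReal_cpow_const t _ (Or.inr (hk ht).ne')

/-- Meromorphic continuation, with a bound in vertical strips, of the Epstein zeta function of a
lattice form. -/
theorem exists_epstein_continuation (z : UpperHalfPlane) {A : ℝ} (hA : 0 < A) :
    ∃ (G : ℂ → ℂ) (c : ℂ) (B : ℝ), (∀ s : ℂ, 0 < s.re → s.re < 3 → DifferentiableAt ℂ G s) ∧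
      (∀ s : ℂ, 1 / 2 ≤ s.re → s.re ≤ 2 → ‖G s‖ ≤ B) ∧
      ∀ s : ℂ, 1 < s.re → s.re < 3 →
        (Real.pi : ℂ) ^ (-s) * Gamma s * ∑' x, 1 / (latticeForm z A x : ℂ) ^ s
          = G s + c / (s - 1) := by
  set θ : ℝ → ℝ := fun t ↦ ∑' x : Fin 2 → ℤ, Real.exp (-Real.pi * latticeForm z A x * t)
  set F : ℝ → ℂ := fun t ↦ ((θ t - 1 : ℝ) : ℂ) with hF
  set c : ℂ := ((1 / (A * z.im) : ℝ) : ℂ) with hc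
  set I : ℝ → ℂ := Set.indicator (Set.Ioc 0 1) (fun t : ℝ ↦ (t : ℂ) ^ (-1 : ℂ)) with hI
  set f : ℝ → ℂ := fun t ↦ F t - c • I t with hf
  have hFli : MeasureTheory.LocallyIntegrableOn F (Set.Ioi 0) :=
    (continuous_ofReal.comp_continuousOn
      ((continuousOn_tsum_exp_neg_latticeForm z hA).sub continuousOn_const)).locallyIntegrableOn
        measurableSet_Ioi
  have hfli : MeasureTheory.LocallyIntegrableOn f (Set.Ioi 0) :=
    hFli.sub (locallyIntegrableOn_indicator_cpow_neg_one.smul c)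
  obtain ⟨M, hM⟩ := exists_abs_theta_sub_one_le z hA
  obtain ⟨C, hC⟩ := exists_abs_theta_sub_le z hA
  have hIval : ∀ t ∈ Set.Ioc (0 : ℝ) 1, c • I t = ((1 / (A * z.im) / t : ℝ) : ℂ) := by
    intro t ht
    rw [hI, Set.indicator_of_mem ht, cpow_neg_one, hc, smul_eq_mul, div_eq_mul_inv _ t]
    push_cast; ring
  have hfbot : ∀ t ∈ Set.Ioc (0 : ℝ) 1, ‖f t‖ ≤ C + 1 := by
    intro t ht
    have := hC t ht
    rw [hf]
    simp only [hF]
    rw [hIval t ht, ← ofReal_sub, norm_real, Real.norm_eq_abs]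
    rw [abs_le] at this ⊢
    constructor <;> simp only [θ] <;> linarith
  have hftop : ∀ t : ℝ, 1 < t → f t = F t := by
    intro t ht
    simp [hf, hI, ht]
  have hFtopO : F =O[atTop] (fun t : ℝ ↦ t ^ (-3 : ℝ)) := by
    refine Asymptotics.IsBigO.of_bound M ?_
    filter_upwards [eventually_gt_atTop 0] with t ht
    rw [Real.norm_of_nonneg (Real.rpow_nonneg ht.le _), hF, norm_real, Real.norm_eq_abs]
    exact hM t ht
  have hftopO : f =O[atTop] (fun t : ℝ ↦ t ^ (-3 : ℝ)) := by
    refine hFtopO.congr' ?_ .rfl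
    filter_upwards [eventually_gt_atTop 1] with t ht using (hftop t ht).symm
  have hfbotO : f =O[nhdsWithin 0 (Set.Ioi 0)] (fun t : ℝ ↦ t ^ (-0 : ℝ)) := by
    refine Asymptotics.IsBigO.of_bound (C + 1) ?_
    filter_upwards [Ioc_mem_nhdsGT (zero_lt_one' ℝ)] with t ht
    simpa using hfbot t ht
  have hconv : ∀ s : ℂ, 0 < s.re → s.re < 3 → MellinConvergent f s := fun s h0 h3 ↦
    mellinConvergent_of_isBigO_rpow hfli hftopO h3 hfbotO h0
  refine ⟨mellin f, c, ∫ t in Set.Ioi (0 : ℝ), (t ^ ((1 : ℝ) / 2 - 1) * ‖f t‖ + t ^ ((2 : ℝ) - 1) * ‖f t‖),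
    fun s h0 h3 ↦ mellin_differentiableAt_of_isBigO_rpow hfli hftopO h3 hfbotO h0, ?_, ?_⟩
  · intro s h1 h2
    have hn : ∀ σ : ℝ, 0 < σ → σ < 3 → MeasureTheory.IntegrableOn (fun t : ℝ ↦ t ^ (σ - 1) * ‖f t‖)
        (Set.Ioi 0) := by
      intro σ h0 h3
      have := hconv σ (by simpa) (by simpa)
      rw [MellinConvergent, mellin_convergent_iff_norm (Set.Subset.refl _) measurableSet_Ioi
        hfli.aestronglyMeasurable] at this
      simpa using this
    refine MeasureTheory.norm_integral_le_of_norm_le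
      ((hn (1 / 2) (by norm_num) (by norm_num)).add (hn 2 (by norm_num) (by norm_num))) ?_
    refine (MeasureTheory.ae_restrict_iff' measurableSet_Ioi).mpr (.of_forall fun t ht ↦ ?_)
    have ht : 0 < t := ht
    rw [norm_smul, norm_cpow_eq_rpow_re_of_pos ht, ← add_mul]
    refine mul_le_mul_of_nonneg_right ?_ (norm_nonneg _)
    rw [sub_re, one_re]
    rcases le_total t 1 with h | h
    · exact (Real.rpow_le_rpow_of_exponent_ge ht h (by linarith)).trans
        (le_add_of_nonneg_right (by positivity))
    · exact (Real.rpow_le_rpow_of_exponent_le h (by linarith)).trans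
        (le_add_of_nonneg_left (by positivity))
  · intro s h1 h3
    have hIm := hasMellin_cpow_Ioc (-1) (s := s) (by simpa)
    have hFc : MellinConvergent F s := by
      have := (hconv s (by linarith) h3).add (hIm.1.const_smul c)
      refine MeasureTheory.Integrable.congr this (.of_forall fun t ↦ ?_)
      simp only [Pi.add_apply, hf, hI, ← smul_add, sub_add_cancel]
    have e1 : mellin F s = mellin f s + c / (s - 1) := by
      have h4 := (hasMellin_const_smul hIm.1 c)
      have h5 := (hasMellin_sub hFc h4.1).2
      have : mellin f s = mellin F s - c / (s - 1) := by
        rw [hf, hI, h5, h4.2, hIm.2]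
        simp [sub_eq_add_neg, div_eq_mul_inv]
      rw [this]; ring
    rw [← e1]
    have key := hasSum_mellin_pi_mul₀ (a := fun _ ↦ 1) (p := latticeForm z A) (F := F) (s := s)
      (latticeForm_nonneg z hA) (by linarith) ?_ ?_
    · rw [← key.tsum_eq, ← tsum_mul_left]
      congr 1; ext x; ring
    · intro t ht
      have := hasSum_ofReal.mpr (tsum_exp_neg_latticeForm_sub_one z hA ht)
      convert! this using 2 with x
      by_cases hx : x = 0
      · simp [hx, latticeForm_zero]
      · simp [hx, (latticeForm_pos z hA hx).ne']
    · refine (summable_latticeForm_rpow z hA h1).congr fun x ↦ ?_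
      rw [Real.rpow_neg (latticeForm_nonneg z hA x)]
      simp

theorem absNorm_span_eq_norm_embedding_sq {K : Type*} [Field K] [NumberField K]
    (hdeg : Module.finrank ℚ K = 2) (himag : ∀ v : InfinitePlace K, v.IsComplex)
    (v : InfinitePlace K) (x : 𝓞 K) :
    (Ideal.absNorm (Ideal.span {x}) : ℝ) = ‖v.embedding x‖ ^ 2 := by
  have : IsTotallyComplex K := ⟨himag⟩
  have hc : InfinitePlace.nrComplexPlaces K = 1 := by
    have := IsTotallyComplex.finrank K
    omega
  have h1 : Fintype.card (InfinitePlace K) = 1 := by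
    rw [InfinitePlace.card_eq_nrRealPlaces_add_nrComplexPlaces, hc,
      nrRealPlaces_eq_zero_iff.mpr this]
  obtain ⟨w, hw⟩ := Fintype.card_eq_one_iff.mp h1
  have h2 := InfinitePlace.prod_eq_abs_norm (x : K)
  rw [Fintype.prod_eq_single v fun u hu ↦ absurd ((hw u).trans (hw v).symm) hu,
    InfinitePlace.mult_isComplex ⟨v, himag v⟩, ← InfinitePlace.norm_embedding_eq] at h2
  rw [h2, Ideal.absNorm_span_singleton, ← Algebra.coe_norm_int]
  push_cast [Nat.cast_natAbs]
  rfl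

theorem im_embedding_div_ne_zero {K : Type*} [Field K] [NumberField K]
    (v : InfinitePlace K) (hv : v.IsComplex) (b : Module.Basis (Fin 2) ℤ (𝓞 K)) :
    (v.embedding (b 0) / v.embedding (b 1)).im ≠ 0 := by
  intro him
  refine (InfinitePlace.isComplex_iff.mp hv) (ComplexEmbedding.isReal_iff.mpr ?_)
  have hb1 : v.embedding (b 1) ≠ 0 := by simpa using b.ne_zero 1
  have hreal : ∀ x : 𝓞 K, ∃ y : ℝ, v.embedding x = y * v.embedding (b 1) := by
    intro x
    refine ⟨b.repr x 0 * (v.embedding (b 0) / v.embedding (b 1)).re + b.repr x 1, ?_⟩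
    have h0 : (((v.embedding (b 0) / v.embedding (b 1)).re : ℝ) : ℂ)
        = v.embedding (b 0) / v.embedding (b 1) := by
      apply Complex.ext <;> simp [him]
    conv_lhs => rw [← b.sum_repr x]
    push_cast
    rw [h0, Fin.sum_univ_two]
    simp
    field_simp
  ext k
  obtain ⟨x, y, hy, rfl⟩ := IsFractionRing.div_surjective (𝓞 K) k
  obtain ⟨p, hp⟩ := hreal x
  obtain ⟨q, hq⟩ := hreal y
  have e : v.embedding (algebraMap (𝓞 K) K x / algebraMap (𝓞 K) K y) = ((p / q : ℝ) : ℂ) := by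
    rw [map_div₀, hp, hq, mul_div_mul_right _ _ hb1]
    push_cast; rfl
  rw [ComplexEmbedding.conjugate_coe_eq, e, conj_ofReal]

/-- The ideal norm on principal ideals of an imaginary quadratic field, written as the quadratic
form of a lattice. -/
theorem exists_equiv_absNorm_span_eq_latticeForm {K : Type*} [Field K] [NumberField K]
    (hdeg : Module.finrank ℚ K = 2) (himag : ∀ v : InfinitePlace K, v.IsComplex) :
    ∃ (e : (Fin 2 → ℤ) ≃ 𝓞 K) (z : UpperHalfPlane) (A : ℝ), 0 < A ∧
      ∀ x, (Ideal.absNorm (Ideal.span {e x}) : ℝ) = latticeForm z A x := by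
  obtain ⟨v⟩ : Nonempty (InfinitePlace K) := inferInstance
  let b : Module.Basis (Fin 2) ℤ (𝓞 K) :=
    Module.finBasisOfFinrankEq ℤ (𝓞 K) ((RingOfIntegers.rank K).trans hdeg)
  have hb1 : v.embedding (b 1) ≠ 0 := by simpa using b.ne_zero 1
  have key : ∀ x : Fin 2 → ℤ, (Ideal.absNorm (Ideal.span {b.equivFun.symm x}) : ℝ)
      = ‖v.embedding (b 1)‖ ^ 2 *
        ‖(x 0 : ℂ) * (v.embedding (b 0) / v.embedding (b 1)) + x 1‖ ^ 2 := by
    intro x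
    rw [absNorm_span_eq_norm_embedding_sq hdeg himag v, ← mul_pow, ← norm_mul,
      b.equivFun_symm_apply, Fin.sum_univ_two]
    congr 2
    simp
    field_simp
  rcases lt_or_gt_of_ne (im_embedding_div_ne_zero v (himag v) b) with h | h
  · refine ⟨b.equivFun.symm.toEquiv, ⟨(starRingEnd ℂ) (v.embedding (b 0) / v.embedding (b 1)),
      by rw [conj_im]; linarith⟩, ‖v.embedding (b 1)‖ ^ 2, by positivity, fun x ↦ ?_⟩
    refine (key x).trans ?_
    rw [latticeForm]
    congr 2
    rw [← norm_conj]
    simp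
  · exact ⟨b.equivFun.symm.toEquiv, ⟨_, h⟩, ‖v.embedding (b 1)‖ ^ 2, by positivity, key⟩

theorem bijective_generator_mul_unit (R : Type*) [CommRing R] [IsDomain R]
    [IsPrincipalIdealRing R] : ∃ g : {I : Ideal R // I ≠ ⊥} × Rˣ ≃ {x : R // x ≠ 0},
      ∀ p, Ideal.span {(g p : R)} = p.1 := by
  have hg : ∀ I : Ideal R, Ideal.span {Submodule.IsPrincipal.generator I} = I :=
    fun I ↦ Submodule.IsPrincipal.span_singleton_generator I
  have h0 : ∀ p : {I : Ideal R // I ≠ ⊥} × Rˣ, Submodule.IsPrincipal.generator p.1.1 * p.2 ≠ 0 := by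
    intro p h
    rw [Units.mul_left_eq_zero, ← Submodule.IsPrincipal.eq_bot_iff_generator_eq_zero] at h
    exact p.1.2 h
  have hspan : ∀ p : {I : Ideal R // I ≠ ⊥} × Rˣ,
      Ideal.span {Submodule.IsPrincipal.generator p.1.1 * (p.2 : R)} = p.1.1 := by
    intro p
    rw [Ideal.span_singleton_mul_right_unit p.2.isUnit, hg]
  refine ⟨Equiv.ofBijective (fun p ↦ ⟨_, h0 p⟩) ⟨?_, ?_⟩, hspan⟩
  · rintro p q h
    have h' := congrArg Subtype.val h
    dsimp only at h'
    have h1 : p.1 = q.1 := by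
      ext1
      rw [← hspan p, ← hspan q, h']
    refine Prod.ext h1 ?_
    rw [h1] at h'
    refine Units.ext (mul_left_cancel₀ ?_ h')
    exact left_ne_zero_of_mul (h0 q)
  · rintro ⟨x, hx⟩
    have hI : Ideal.span {x} ≠ ⊥ := by simpa using hx
    obtain ⟨u, hu⟩ := Ideal.span_singleton_eq_span_singleton.mp (hg (Ideal.span {x}))
    exact ⟨⟨⟨Ideal.span {x}, hI⟩, u⟩, Subtype.ext hu⟩

theorem tsum_span_singleton_eq (R : Type*) [CommRing R] [IsDomain R]
    [IsPrincipalIdealRing R] {f : Ideal R → ℂ} (h0 : f ⊥ = 0) (h1 : f ⊤ ≠ 0)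
    (hs : Summable fun x : R ↦ f (Ideal.span {x})) :
    Finite Rˣ ∧ Summable f ∧
      ∑' x : R, f (Ideal.span {x}) = Nat.card Rˣ * ∑' I : {I : Ideal R // I ≠ ⊥}, f I := by
  obtain ⟨g, hg⟩ := bijective_generator_mul_unit R
  have hs1 : Summable fun x : {x : R // x ≠ 0} ↦ f (Ideal.span {(x : R)}) :=
    hs.comp_injective Subtype.val_injective
  rw [← g.summable_iff] at hs1
  have e1 : (fun x : {x : R // x ≠ 0} ↦ f (Ideal.span {(x : R)})) ∘ g = fun p ↦ f p.1 := by
    ext p; simp [hg]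
  rw [e1] at hs1
  have hfin : Finite Rˣ := by
    by_contra hinf
    rw [not_finite_iff_infinite] at hinf
    have := hs1.comp_injective (Prod.mk_right_injective (⟨⊤, top_ne_bot⟩ : {I : Ideal R // I ≠ ⊥}))
    exact h1 ((summable_const_iff (f ⊤)).mp this)
  have := Fintype.ofFinite Rˣ
  have hs2 : Summable fun I : {I : Ideal R // I ≠ ⊥} ↦ f I :=
    hs1.comp_injective (Prod.mk_left_injective (1 : Rˣ))
  refine ⟨hfin, ?_, ?_⟩
  · refine (Function.Injective.summable_iff Subtype.val_injective ?_).mp hs2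
    intro I hI
    have : I = ⊥ := by simpa using hI
    rw [this, h0]
  · have e2 : ∑' x : R, f (Ideal.span {x}) = ∑' x : {x : R // x ≠ 0}, f (Ideal.span {(x : R)}) := by
      refine (tsum_subtype_eq_of_support_subset (s := {x : R | x ≠ 0}) fun x hx h ↦ hx ?_).symm
      rw [h, Ideal.span_singleton_zero, h0]
    rw [e2, ← g.tsum_eq, show (fun c ↦ f (Ideal.span {(g c : R)})) = fun p ↦ f p.1 from e1,
      hs1.tsum_prod, ← tsum_mul_left]
    simp [Nat.card_eq_fintype_card]

/-- The completely multiplicative function `I ↦ N(I)⁻ˢ` on ideals. -/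
noncomputable def absNormCpow (K : Type*) [Field K] [NumberField K] {s : ℂ} (hs : s ≠ 0) :
    Ideal (𝓞 K) →*₀ ℂ where
  toFun I := (Ideal.absNorm I : ℂ) ^ (-s)
  map_zero' := by simp [hs]
  map_one' := by simp
  map_mul' I J := by
    rw [map_mul, Nat.cast_mul, natCast_mul_natCast_cpow]

theorem norm_absNorm_cpow (K : Type*) [Field K] [NumberField K] {s : ℂ} (hs : 1 < s.re)
    (I : Ideal (𝓞 K)) : ‖(Ideal.absNorm I : ℂ) ^ (-s)‖ = (Ideal.absNorm I : ℝ) ^ (-s.re) := by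
  rw [norm_natCast_cpow_of_re_ne_zero _ (by simp; linarith), neg_re]

theorem dedekindZetaSum_eq_tsum (K : Type*) [Field K] [NumberField K] {s : ℂ} (hs : s ≠ 0) :
    dedekindZetaSum K s = ∑' I : Ideal (𝓞 K), (Ideal.absNorm I : ℂ) ^ (-s) := by
  refine tsum_subtype_eq_of_support_subset (f := fun I : Ideal (𝓞 K) ↦
    (Ideal.absNorm I : ℂ) ^ (-s)) (s := {I | I ≠ ⊥}) fun I hI h ↦ hI ?_
  simp [h, hs]

theorem exists_dedekindZetaSum_eq_epstein {K : Type*} [Field K] [NumberField K]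
    (hdeg : Module.finrank ℚ K = 2) (himag : ∀ v : InfinitePlace K, v.IsComplex)
    (hclass : classNumber K = 1) :
    (∀ σ : ℝ, 1 < σ → Summable fun I : Ideal (𝓞 K) ↦ (Ideal.absNorm I : ℝ) ^ (-σ)) ∧
    ∃ (z : UpperHalfPlane) (A : ℝ) (w : ℂ), 0 < A ∧ w ≠ 0 ∧ ∀ s : ℂ, 1 < s.re →
      ∑' x, 1 / (latticeForm z A x : ℂ) ^ s = w * dedekindZetaSum K s := by
  have := classNumber_eq_one_iff.mp hclass
  obtain ⟨e, z, A, hA, he⟩ := exists_equiv_absNorm_span_eq_latticeForm hdeg himag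
  have key : ∀ s : ℂ, 1 < s.re →
      Finite (𝓞 K)ˣ ∧ Summable (fun I : Ideal (𝓞 K) ↦ (Ideal.absNorm I : ℂ) ^ (-s)) ∧
      ∑' x : 𝓞 K, (Ideal.absNorm (Ideal.span {x}) : ℂ) ^ (-s)
        = Nat.card (𝓞 K)ˣ * dedekindZetaSum K s := by
    intro s hs
    have hs0 : s ≠ 0 := by rintro rfl; simp at hs; linarith
    refine tsum_span_singleton_eq (𝓞 K) (f := fun I ↦ (Ideal.absNorm I : ℂ) ^ (-s))
      (by simp [hs0]) (by simp) ?_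
    rw [← e.summable_iff]
    refine .of_norm ?_
    convert! summable_latticeForm_rpow z hA hs using 2 with x
    rw [Function.comp_apply, norm_absNorm_cpow K hs, he]
  obtain ⟨hfin, -, -⟩ := key 2 (by norm_num)
  refine ⟨fun σ hσ ↦ ?_, z, A, Nat.card (𝓞 K)ˣ, hA, by simp [Nat.card_pos.ne'], fun s hs ↦ ?_⟩
  · have := (key σ (by simpa)).2.1.norm
    simpa only [norm_absNorm_cpow K (s := σ) (by simpa), ofReal_re] using this
  · rw [← (key s hs).2.2, ← e.tsum_eq]
    refine tsum_congr fun x ↦ ?_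
    rw [← he, one_div, ← cpow_neg, ofReal_natCast]

theorem norm_dedekindZetaSum_le {K : Type*} [Field K] [NumberField K] {σ : ℝ} (hσ : 1 < σ)
    (hK : Summable fun I : Ideal (𝓞 K) ↦ (Ideal.absNorm I : ℝ) ^ (-σ)) {s : ℂ} (hs : σ ≤ s.re) :
    ‖dedekindZetaSum K s‖ ≤ ∑' I : Ideal (𝓞 K), (Ideal.absNorm I : ℝ) ^ (-σ) ∧
    1 / 2 ≤ ‖dedekindZetaSum K s‖ * ∑' I : Ideal (𝓞 K), (Ideal.absNorm I : ℝ) ^ (-σ) := by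
  have hs1 : 1 < s.re := by linarith
  have hs0 : s ≠ 0 := by rintro rfl; simp at hs; linarith
  have hle : ∀ I : Ideal (𝓞 K), ‖(Ideal.absNorm I : ℂ) ^ (-s)‖ ≤ (Ideal.absNorm I : ℝ) ^ (-σ) := by
    intro I
    rw [norm_absNorm_cpow K hs1]
    rcases eq_or_ne I ⊥ with rfl | hI
    · simp [Real.zero_rpow (show -s.re ≠ 0 by linarith), Real.zero_rpow (show -σ ≠ 0 by linarith)]
    · refine Real.rpow_le_rpow_of_exponent_le ?_ (by linarith)
      exact_mod_cast Nat.one_le_iff_ne_zero.mpr (Ideal.absNorm_eq_zero_iff.not.mpr hI)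
  have hsum : Summable fun I : Ideal (𝓞 K) ↦ ‖(Ideal.absNorm I : ℂ) ^ (-s)‖ :=
    hK.of_nonneg_of_le (fun _ ↦ norm_nonneg _) hle
  rw [dedekindZetaSum_eq_tsum K hs0]
  refine ⟨tsum_of_norm_bounded hK.hasSum hle, ?_⟩
  refine (half_le_norm_tsum_mul_tsum_norm (absNormCpow K hs0) hsum fun I ↦ ?_).trans ?_
  · change ‖(Ideal.absNorm I : ℂ) ^ (-s)‖ ≤ 1
    rw [norm_absNorm_cpow K hs1]
    rcases eq_or_ne I ⊥ with rfl | hI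
    · simp [Real.zero_rpow (show -s.re ≠ 0 by linarith)]
    · refine Real.rpow_le_one_of_one_le_of_nonpos ?_ (by linarith)
      exact_mod_cast Nat.one_le_iff_ne_zero.mpr (Ideal.absNorm_eq_zero_iff.not.mpr hI)
  · exact mul_le_mul_of_nonneg_left (hsum.tsum_le_tsum hle hK) (norm_nonneg _)

theorem dedekindZetaSum_conj (K : Type*) [Field K] [NumberField K] (s : ℂ) :
    dedekindZetaSum K ((starRingEnd ℂ) s) = (starRingEnd ℂ) (dedekindZetaSum K s) := by
  rw [dedekindZetaSum, dedekindZetaSum, conj_tsum]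
  refine tsum_congr fun I ↦ ?_
  rw [← map_neg, cpow_conj _ _ (by rw [natCast_arg]; exact Real.pi_pos.ne), conj_natCast]

theorem exists_norm_Gamma_le (a b : ℝ) (ha : 0 < a) :
    ∃ C : ℝ, ∀ s : ℂ, a ≤ s.re → s.re ≤ b → ‖Gamma s‖ ≤ C := by
  rcases lt_or_ge b a with hab | hab
  · exact ⟨0, fun s h1 h2 ↦ by linarith⟩
  refine ⟨∫ x in Set.Ioi (0 : ℝ), (Real.exp (-x) * x ^ (a - 1) + Real.exp (-x) * x ^ (b - 1)),
    fun s h1 h2 ↦ ?_⟩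
  rw [Gamma_eq_integral (by linarith)]
  refine MeasureTheory.norm_integral_le_of_norm_le
    ((Real.GammaIntegral_convergent ha).add (Real.GammaIntegral_convergent (ha.trans_le hab))) ?_
  refine (MeasureTheory.ae_restrict_iff' measurableSet_Ioi).mpr (.of_forall fun t ht ↦ ?_)
  have ht : 0 < t := ht
  rw [norm_mul, norm_cpow_eq_rpow_re_of_pos ht, norm_real, Real.norm_of_nonneg (Real.exp_nonneg _),
    ← mul_add, sub_re, one_re]
  refine mul_le_mul_of_nonneg_left ?_ (Real.exp_nonneg _)
  rcases le_total t 1 with h | h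
  · exact (Real.rpow_le_rpow_of_exponent_ge ht h (by linarith)).trans
      (le_add_of_nonneg_right (by positivity))
  · exact (Real.rpow_le_rpow_of_exponent_le h (by linarith)).trans
      (le_add_of_nonneg_left (by positivity))

theorem norm_sin_le_exp_abs_im (z : ℂ) : ‖sin z‖ ≤ Real.exp |z.im| := by
  rw [Complex.sin, norm_div, norm_mul, norm_I, mul_one, Complex.norm_two]
  have h1 : ‖cexp (-z * I)‖ ≤ Real.exp |z.im| := by
    rw [norm_exp]
    simpa using le_abs_self z.im
  have h2 : ‖cexp (z * I)‖ ≤ Real.exp |z.im| := by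
    rw [norm_exp]
    simpa using neg_le_abs z.im
  linarith [norm_sub_le (cexp (-z * I)) (cexp (z * I))]

/-- A lower bound for the Gamma function in a vertical strip. -/
theorem exists_one_le_norm_Gamma_mul_exp : ∃ C : ℝ, 0 < C ∧ ∀ s : ℂ, 1 ≤ s.re → s.re ≤ 3 →
    1 ≤ |s.im| → 1 ≤ ‖Gamma s‖ * (C * Real.exp (Real.pi * ‖s‖)) := by
  obtain ⟨C, hC⟩ := exists_norm_Gamma_le 2 4 (by norm_num)
  have hC0 : 0 ≤ C := (norm_nonneg _).trans (hC 2 (by norm_num) (by norm_num))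
  refine ⟨C + 1, by positivity, fun s h1 h3 him ↦ ?_⟩
  have hk : ∀ k : ℝ, 1 ≤ ‖(k : ℂ) - s‖ := fun k ↦ by
    refine him.trans ((le_of_eq ?_).trans (abs_im_le_norm _))
    simp
  have hk0 : ∀ k : ℝ, (k : ℂ) - s ≠ 0 := fun k ↦ norm_pos_iff.mp (zero_lt_one.trans_le (hk k))
  have hG : ‖Gamma (1 - s)‖ ≤ C := by
    have e : ∀ k : ℝ, ‖Gamma (k - s)‖ ≤ ‖Gamma ((k + 1 : ℝ) - s)‖ := fun k ↦ by
      have : ((k + 1 : ℝ) : ℂ) - s = (k - s) + 1 := by push_cast; ring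
      rw [this, Gamma_add_one _ (hk0 k), norm_mul]
      exact le_mul_of_one_le_left (norm_nonneg _) (hk k)
    have e4 := (e 1).trans ((e (1 + 1)).trans ((e (1 + 1 + 1)).trans (e (1 + 1 + 1 + 1))))
    refine le_trans (by simpa using e4) (hC _ ?_ ?_) <;> simp <;> linarith
  have hsin : sin (Real.pi * s) ≠ 0 := by
    rw [sin_ne_zero_iff]
    intro k hk
    have hk' : s = k := by
      have : (Real.pi : ℂ) ≠ 0 := by exact_mod_cast Real.pi_ne_zero
      rw [mul_comm (k : ℂ)] at hk
      exact mul_left_cancel₀ this hk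
    rw [hk'] at him
    simp at him
    linarith
  have hrefl := Gamma_mul_Gamma_one_sub s
  have hs := norm_sin_le_exp_abs_im (Real.pi * s)
  have him2 : |(Real.pi * s : ℂ).im| ≤ Real.pi * ‖s‖ := by
    simp [abs_mul, abs_of_pos Real.pi_pos]
    exact mul_le_mul_of_nonneg_left (abs_im_le_norm s) Real.pi_pos.le
  have hs' : ‖sin (Real.pi * s)‖ ≤ Real.exp (Real.pi * ‖s‖) := hs.trans (Real.exp_le_exp.mpr him2)
  rw [eq_div_iff hsin] at hrefl
  have hn := congrArg norm hrefl
  rw [norm_mul, norm_mul, norm_real, Real.norm_of_nonneg Real.pi_pos.le] at hn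
  calc (1 : ℝ) ≤ Real.pi := by linarith [Real.pi_gt_three]
    _ = _ := hn.symm
    _ ≤ ‖Gamma s‖ * C * Real.exp (Real.pi * ‖s‖) := by gcongr
    _ ≤ ‖Gamma s‖ * (C + 1) * Real.exp (Real.pi * ‖s‖) := by gcongr; linarith
    _ = _ := by ring

theorem norm_Gamma_le_of_one_le_re {s : ℂ} {t : ℝ} (hs : 1 ≤ s.re) (ht : 1 ≤ t) :
    ‖Gamma s‖ * Real.Gamma t ≤ ‖Gamma (s + t)‖ := by
  have hb : ‖betaIntegral s t‖ ≤ 1 := by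
    have := intervalIntegral.norm_integral_le_of_norm_le_const (a := 0) (b := 1) (C := 1)
      (f := fun x : ℝ ↦ (x : ℂ) ^ (s - 1) * (1 - (x : ℂ)) ^ ((t : ℂ) - 1)) fun x hx ↦ ?_
    · simpa [betaIntegral] using this
    · rw [Set.uIoc_of_le zero_le_one] at hx
      have h1 : ‖(x : ℂ) ^ (s - 1)‖ ≤ 1 := by
        rw [norm_cpow_eq_rpow_re_of_pos hx.1]
        exact Real.rpow_le_one hx.1.le hx.2 (by simpa using hs)
      have h2 : ‖(1 - (x : ℂ)) ^ ((t : ℂ) - 1)‖ ≤ 1 := by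
        have e : (1 - (x : ℂ)) ^ ((t : ℂ) - 1) = (((1 - x) ^ (t - 1) : ℝ) : ℂ) := by
          rw [ofReal_cpow (by linarith [hx.2])]
          push_cast; rfl
        have h0 : 0 ≤ 1 - x := by linarith [hx.2]
        rw [e, norm_real, Real.norm_of_nonneg (Real.rpow_nonneg h0 _)]
        exact Real.rpow_le_one h0 (by linarith [hx.1]) (by linarith)
      rw [norm_mul]
      exact mul_le_one₀ h1 (norm_nonneg _) h2
  have h := congrArg norm (Gamma_mul_Gamma_eq_betaIntegral (s := s) (t := t) (by linarith)
    (by simp; linarith))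
  rw [norm_mul, norm_mul, Gamma_ofReal, norm_real, Real.norm_of_nonneg
    (Real.Gamma_pos_of_pos (by linarith)).le] at h
  rw [h]
  exact mul_le_of_le_one_right (norm_nonneg _) hb

section ShiftInequality

variable {ξ D : ℂ → ℂ} {κ : ℝ}

theorem completed_conj (hκ : 0 < κ)
    (hξD : ∀ s : ℂ, 1 < s.re → ξ s = s * (s - 1) * ((κ : ℂ) ^ s * Gamma s * D s))
    (hconj : ∀ s, D ((starRingEnd ℂ) s) = (starRingEnd ℂ) (D s)) {s : ℂ} (hs : 1 < s.re) :
    ξ ((starRingEnd ℂ) s) = (starRingEnd ℂ) (ξ s) := by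
  have hκ' : (κ : ℂ) ^ (starRingEnd ℂ) s = (starRingEnd ℂ) ((κ : ℂ) ^ s) := by
    rw [cpow_conj _ _ (by rw [arg_ofReal_of_nonneg hκ.le]; exact Real.pi_pos.ne), conj_ofReal]
  rw [hξD s hs, hξD _ (by simpa using hs), hconj, hκ', Gamma_conj]
  simp

theorem completed_ne_zero (hκ : 0 < κ)
    (hξD : ∀ s : ℂ, 1 < s.re → ξ s = s * (s - 1) * ((κ : ℂ) ^ s * Gamma s * D s))
    (hDb : ∀ σ : ℝ, 1 < σ → ∃ M : ℝ, ∀ s : ℂ, σ ≤ s.re → ‖D s‖ ≤ M ∧ 1 / 2 ≤ ‖D s‖ * M)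
    {s : ℂ} (hs : 1 < s.re) : ξ s ≠ 0 := by
  obtain ⟨M, hM⟩ := hDb s.re hs
  have hD : D s ≠ 0 := fun h ↦ by
    have := (hM s le_rfl).2
    norm_num [h] at this
  have h0 : s ≠ 0 := by rintro rfl; simp at hs; linarith
  have h1 : s - 1 ≠ 0 := by
    intro h; rw [sub_eq_zero.mp h] at hs; simp at hs
  rw [hξD s hs]
  have hκ' : (κ : ℂ) ^ s ≠ 0 := by
    rw [cpow_ne_zero_iff]; left; exact_mod_cast hκ.ne'
  have := Gamma_ne_zero_of_re_pos (s := s) (by linarith)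
  positivity

theorem exists_norm_completed_sub_le_mul (hκ : 0 < κ)
    (hξD : ∀ s : ℂ, 1 < s.re → ξ s = s * (s - 1) * ((κ : ℂ) ^ s * Gamma s * D s))
    (hDb : ∀ σ : ℝ, 1 < σ → ∃ M : ℝ, ∀ s : ℂ, σ ≤ s.re → ‖D s‖ ≤ M ∧ 1 / 2 ≤ ‖D s‖ * M)
    {δ : ℝ} (hδ : 0 < δ) :
    ∃ B : ℝ, ∀ w : ℂ, 1 + 2 * δ ≤ w.re → ‖ξ (w - δ)‖ ≤ B * ‖ξ (1 + δ + w)‖ := by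
  obtain ⟨M, hM⟩ := hDb (1 + δ) (by linarith)
  have hg : 0 < Real.Gamma (1 + 2 * δ) := Real.Gamma_pos_of_pos (by linarith)
  refine ⟨2 * M ^ 2 * (κ ^ (1 + 2 * δ))⁻¹ * (Real.Gamma (1 + 2 * δ))⁻¹, fun w hw ↦ ?_⟩
  have hre1 : (w - δ).re = w.re - δ := by simp
  have hre2 : (1 + δ + w).re = 1 + δ + w.re := by simp
  rw [hξD _ (by rw [hre1]; linarith), hξD _ (by rw [hre2]; linarith)]
  obtain ⟨hD1, hD1'⟩ := hM (w - δ) (by rw [hre1]; linarith)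
  obtain ⟨hD2, hD2'⟩ := hM (1 + δ + w) (by rw [hre2]; linarith)
  have hM0 : 0 ≤ M := (norm_nonneg _).trans hD1
  have hΓ := norm_Gamma_le_of_one_le_re (s := w - δ) (t := 1 + 2 * δ) (by rw [hre1]; linarith)
    (by linarith)
  rw [show w - δ + ((1 + 2 * δ : ℝ) : ℂ) = 1 + δ + w by push_cast; ring,
    ← le_div_iff₀ hg, div_eq_mul_inv] at hΓ
  have hDD : ‖D (w - δ)‖ ≤ 2 * M ^ 2 * ‖D (1 + δ + w)‖ := by nlinarith
  have hκκ : ‖(κ : ℂ) ^ (w - δ)‖ = (κ ^ (1 + 2 * δ))⁻¹ * ‖(κ : ℂ) ^ (1 + δ + w)‖ := by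
    rw [norm_cpow_eq_rpow_re_of_pos hκ, norm_cpow_eq_rpow_re_of_pos hκ, ← Real.rpow_neg hκ.le,
      ← Real.rpow_add hκ, hre1, hre2]
    congr 1; ring
  have hn : ∀ p q : ℂ, |p.re| ≤ |q.re| → p.im = q.im → ‖p‖ ≤ ‖q‖ := by
    intro p q h1 h2
    rw [← abs_norm p, ← abs_norm q, ← sq_le_sq, ← normSq_eq_norm_sq, ← normSq_eq_norm_sq,
      normSq_apply, normSq_apply, h2]
    have := sq_le_sq.mpr h1
    nlinarith
  have hn1 : ‖w - δ‖ ≤ ‖1 + δ + w‖ := by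
    refine hn _ _ ?_ (by simp)
    rw [hre1, hre2, abs_of_nonneg (by linarith), abs_of_nonneg (by linarith)]; linarith
  have hn2 : ‖w - δ - 1‖ ≤ ‖1 + δ + w - 1‖ := by
    refine hn _ _ ?_ (by simp)
    rw [sub_re, hre1, sub_re, hre2, one_re, abs_of_nonneg (by linarith),
      abs_of_nonneg (by linarith)]
    linarith
  simp only [norm_mul]
  rw [hκκ]
  calc _ ≤ ‖1 + δ + w‖ * ‖1 + δ + w - 1‖ * ((κ ^ (1 + 2 * δ))⁻¹ * ‖(κ : ℂ) ^ (1 + δ + w)‖ *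
        (‖Gamma (1 + δ + w)‖ * (Real.Gamma (1 + 2 * δ))⁻¹) * (2 * M ^ 2 * ‖D (1 + δ + w)‖)) := by
        gcongr
    _ = _ := by ring

theorem exists_one_le_norm_completed_mul_exp (hκ : 0 < κ)
    (hξD : ∀ s : ℂ, 1 < s.re → ξ s = s * (s - 1) * ((κ : ℂ) ^ s * Gamma s * D s))
    (hDb : ∀ σ : ℝ, 1 < σ → ∃ M : ℝ, ∀ s : ℂ, σ ≤ s.re → ‖D s‖ ≤ M ∧ 1 / 2 ≤ ‖D s‖ * M)
    {σ : ℝ} (hσ : 1 < σ) :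
    ∃ B : ℝ, 0 < B ∧ ∀ s : ℂ, σ ≤ s.re → s.re ≤ 3 → 1 ≤ |s.im| →
      1 ≤ ‖ξ s‖ * (B * Real.exp (Real.pi * ‖s‖)) := by
  obtain ⟨M, hM⟩ := hDb σ hσ
  obtain ⟨C, hC, hΓ⟩ := exists_one_le_norm_Gamma_mul_exp
  have hM0 : 0 < M := by
    obtain ⟨h1, h2⟩ := hM σ (by simp)
    by_contra! h
    nlinarith [norm_nonneg (D σ)]
  set k : ℝ := 1 + (κ⁻¹) ^ (3 : ℝ) with hk
  have hk0 : 0 < k := by positivity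
  refine ⟨k * C * (2 * M), by positivity, fun s h1 h3 him ↦ ?_⟩
  have hκs : 1 ≤ ‖(κ : ℂ) ^ s‖ * k := by
    rw [norm_cpow_eq_rpow_re_of_pos hκ]
    rcases le_total 1 κ with h | h
    · have := Real.one_le_rpow h (show 0 ≤ s.re by linarith)
      have h4 : 1 ≤ k := le_add_of_nonneg_right (by positivity)
      exact one_le_mul_of_one_le_of_one_le this h4
    · have h4 := Real.rpow_le_rpow_of_exponent_ge hκ h h3
      calc 1 = κ ^ (3 : ℝ) * κ⁻¹ ^ (3 : ℝ) := by
            rw [← Real.mul_rpow hκ.le (by positivity), mul_inv_cancel₀ hκ.ne', Real.one_rpow]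
        _ ≤ κ ^ s.re * k := by gcongr; rw [hk]; linarith
  have hs0 : 1 ≤ ‖s‖ := him.trans (abs_im_le_norm s)
  have hs1 : 1 ≤ ‖s - 1‖ := him.trans (by simpa using abs_im_le_norm (s - 1))
  have hG := hΓ s (by linarith) h3 him
  have hD := (hM s h1).2
  rw [hξD s (by linarith)]
  simp only [norm_mul]
  have e1 := one_le_mul_of_one_le_of_one_le hs0 hs1
  have e2 := one_le_mul_of_one_le_of_one_le hκs hG
  have e3 := one_le_mul_of_one_le_of_one_le e2 (show 1 ≤ ‖D s‖ * (2 * M) by linarith)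
  have e4 := one_le_mul_of_one_le_of_one_le e1 e3
  refine e4.trans (le_of_eq ?_)
  ring

theorem norm_completed_sub_le (hξ : Differentiable ℂ ξ) (hκ : 0 < κ)
    (hξD : ∀ s : ℂ, 1 < s.re → ξ s = s * (s - 1) * ((κ : ℂ) ^ s * Gamma s * D s))
    (hfe : ∀ s, ξ (1 - s) = ξ s)
    (hconj : ∀ s, D ((starRingEnd ℂ) s) = (starRingEnd ℂ) (D s))
    (hDb : ∀ σ : ℝ, 1 < σ → ∃ M : ℝ, ∀ s : ℂ, σ ≤ s.re → ‖D s‖ ≤ M ∧ 1 / 2 ≤ ‖D s‖ * M)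
    (hgrowth : ∃ C : ℝ, ∀ s : ℂ, -1 ≤ s.re → s.re ≤ 2 → ‖ξ s‖ ≤ C * (1 + ‖s‖) ^ 2)
    {δ : ℝ} (hδ : 0 < δ) (hδ' : δ ≤ 1 / 3) {w : ℂ} (hw : 0 ≤ w.re) :
    ‖ξ (w - δ)‖ ≤ ‖ξ (1 + δ + w)‖ := by
  have hre : ∀ w : ℂ, (1 + δ + w).re = 1 + δ + w.re := fun w ↦ by simp
  have hne : ∀ w : ℂ, 0 ≤ w.re → ξ (1 + δ + w) ≠ 0 := fun w hw ↦
    completed_ne_zero hκ hξD hDb (by rw [hre]; linarith)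
  obtain ⟨B₁, hB₁⟩ := exists_norm_completed_sub_le_mul hκ hξD hDb hδ
  obtain ⟨B₂, hB₂0, hB₂⟩ := exists_one_le_norm_completed_mul_exp hκ hξD hDb
    (show 1 < 1 + δ by linarith)
  obtain ⟨C, hC⟩ := hgrowth
  have hC0 : 0 ≤ C := by
    have := (norm_nonneg _).trans (hC 0 (by simp) (by simp))
    simpa using this
  have hdiff : ∀ w : ℂ, 0 ≤ w.re → DifferentiableAt ℂ (fun w ↦ ξ (w - δ) / ξ (1 + δ + w)) w :=
    fun w hw ↦ ((hξ _).comp w (by fun_prop)).div ((hξ _).comp w (by fun_prop)) (hne w hw)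
  have hlarge : ∀ w : ℂ, 1 + 2 * δ ≤ w.re → ‖ξ (w - δ) / ξ (1 + δ + w)‖ ≤ B₁ := fun w hw ↦ by
    rw [norm_div, div_le_iff₀ (norm_pos_iff.mpr (hne w (by linarith)))]
    exact hB₁ w hw
  have hstrip : ∀ w : ℂ, 0 < w.re → w.re ≤ 1 + 2 * δ → 4 ≤ ‖w‖ →
      ‖ξ (w - δ) / ξ (1 + δ + w)‖ ≤
        (C * 4 * B₂ * Real.exp (2 * Real.pi)) * Real.exp ((2 + Real.pi) * ‖w‖ ^ (1 : ℝ)) := by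
    intro w h0 h1 h4
    have him : 1 ≤ |w.im| := by
      have := norm_le_abs_re_add_abs_im w
      rw [abs_of_pos h0] at this
      linarith
    have hnum := hC (w - δ) (by simp; linarith) (by simp; linarith)
    have hden := hB₂ (1 + δ + w) (by rw [hre]; linarith) (by rw [hre]; linarith) (by simpa)
    have hn1 : ‖w - δ‖ ≤ ‖w‖ + 1 := (norm_sub_le _ _).trans (by
      rw [norm_real, Real.norm_of_nonneg hδ.le]; linarith)
    have hn2 : ‖1 + δ + w‖ ≤ 2 + ‖w‖ := (norm_add_le _ _).trans (by
      gcongr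
      refine (norm_add_le _ _).trans ?_
      rw [norm_real, Real.norm_of_nonneg hδ.le, norm_one]; linarith)
    have hexp : (1 + ‖w - δ‖) ^ 2 ≤ 4 * Real.exp (2 * ‖w‖) := by
      have e := Real.add_one_le_exp ‖w‖
      have : Real.exp (2 * ‖w‖) = Real.exp ‖w‖ ^ 2 := by rw [← Real.exp_nat_mul]; norm_num
      rw [this]
      have : 1 + ‖w - δ‖ ≤ 2 * Real.exp ‖w‖ := by linarith [norm_nonneg w]
      calc _ ≤ (2 * Real.exp ‖w‖) ^ 2 := by gcongr
        _ = _ := by ring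
    rw [norm_div, div_le_iff₀ (norm_pos_iff.mpr (hne w h0.le)), Real.rpow_one]
    calc ‖ξ (w - δ)‖ ≤ C * (1 + ‖w - δ‖) ^ 2 := hnum
      _ ≤ C * (4 * Real.exp (2 * ‖w‖)) * 1 := by rw [mul_one]; gcongr
      _ ≤ C * (4 * Real.exp (2 * ‖w‖)) *
          (‖ξ (1 + δ + w)‖ * (B₂ * Real.exp (Real.pi * ‖1 + δ + w‖))) := by gcongr
      _ ≤ C * (4 * Real.exp (2 * ‖w‖)) *
          (‖ξ (1 + δ + w)‖ * (B₂ * Real.exp (Real.pi * (2 + ‖w‖)))) := by gcongr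
      _ = _ := by
        rw [mul_add, Real.exp_add, add_mul, Real.exp_add, mul_comm Real.pi 2]; ring
  have key := PhragmenLindelof.right_half_plane_of_bounded_on_real (C := 1)
    (f := fun w ↦ ξ (w - δ) / ξ (1 + δ + w)) (z := w) ?_ ?_ ?_ ?_ hw
  · rwa [norm_div, div_le_one (norm_pos_iff.mpr (hne w hw))] at key
  · refine DifferentiableOn.diffContOnCl fun w hw ↦ (hdiff w ?_).differentiableWithinAt
    rwa [closure_setOfPred_lt_re] at hw
  · refine ⟨1, by norm_num, 2 + Real.pi, ?_⟩
    refine Asymptotics.IsBigO.of_bound (max B₁ (C * 4 * B₂ * Real.exp (2 * Real.pi))) ?_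
    rw [eventually_inf_principal]
    filter_upwards [tendsto_norm_cobounded_atTop.eventually_ge_atTop 4] with w h4 h0
    rw [Real.norm_of_nonneg (Real.exp_nonneg _)]
    have hexp : 1 ≤ Real.exp ((2 + Real.pi) * ‖w‖ ^ (1 : ℝ)) :=
      Real.one_le_exp (mul_nonneg (by linarith [Real.pi_pos]) (by positivity))
    rcases le_total w.re (1 + 2 * δ) with h | h
    · exact (hstrip w h0 h h4).trans (by gcongr; exact le_max_right _ _)
    · have hb := hlarge w h
      have hb0 : 0 ≤ B₁ := (norm_nonneg _).trans hb
      exact hb.trans ((le_mul_of_one_le_right hb0 hexp).trans (by gcongr; exact le_max_left _ _))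
  · refine ⟨B₁, ?_⟩
    rw [eventually_map]
    filter_upwards [eventually_ge_atTop (1 + 2 * δ)] with x hx
    exact hlarge x (by simpa)
  · intro x
    have h1 : ξ (x * I - δ) = (starRingEnd ℂ) (ξ (1 + δ + x * I)) := by
      rw [← completed_conj hκ hξD hconj (by simp; linarith), ← hfe]
      congr 1
      simp
      ring
    rw [norm_div, h1, norm_conj]
    exact div_self_le_one _

/-- A completed zeta function decreases in absolute value under a left shift by one. -/
theorem norm_completed_le_shift (hξ : Differentiable ℂ ξ) (hκ : 0 < κ)
    (hξD : ∀ s : ℂ, 1 < s.re → ξ s = s * (s - 1) * ((κ : ℂ) ^ s * Gamma s * D s))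
    (hfe : ∀ s, ξ (1 - s) = ξ s)
    (hconj : ∀ s, D ((starRingEnd ℂ) s) = (starRingEnd ℂ) (D s))
    (hDb : ∀ σ : ℝ, 1 < σ → ∃ M : ℝ, ∀ s : ℂ, σ ≤ s.re → ‖D s‖ ≤ M ∧ 1 / 2 ≤ ‖D s‖ * M)
    (hgrowth : ∃ C : ℝ, ∀ s : ℂ, -1 ≤ s.re → s.re ≤ 2 → ‖ξ s‖ ≤ C * (1 + ‖s‖) ^ 2)
    {w : ℂ} (hw : 0 ≤ w.re) : ‖ξ w‖ ≤ ‖ξ (1 + w)‖ := by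
  have hc := hξ.continuous
  have h1 : Tendsto (fun δ : ℝ ↦ ‖ξ (w - δ)‖) (nhdsWithin 0 (Set.Ioi 0)) (nhds ‖ξ w‖) := by
    have : Continuous (fun δ : ℝ ↦ ‖ξ (w - δ)‖) := by fun_prop
    simpa using (this.tendsto 0).mono_left nhdsWithin_le_nhds
  have h2 : Tendsto (fun δ : ℝ ↦ ‖ξ (1 + δ + w)‖) (nhdsWithin 0 (Set.Ioi 0))
      (nhds ‖ξ (1 + w)‖) := by
    have : Continuous (fun δ : ℝ ↦ ‖ξ (1 + δ + w)‖) := by fun_prop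
    simpa using (this.tendsto 0).mono_left nhdsWithin_le_nhds
  refine le_of_tendsto_of_tendsto h1 h2 ?_
  filter_upwards [Ioc_mem_nhdsGT (show (0 : ℝ) < 1 / 3 by norm_num)] with δ hδ
  exact norm_completed_sub_le hξ hκ hξD hfe hconj hDb hgrowth hδ.1 hδ.2 hw

end ShiftInequality

theorem completed_functional_equation {ξ Λ : ℂ → ℂ} (hξ : Differentiable ℂ ξ)
    (hξeq : ∀ s : ℂ, s ≠ 0 → s ≠ 1 → ξ s = s * (s - 1) * Λ s)
    (hfe : ∀ s : ℂ, Λ s = Λ (1 - s)) (s : ℂ) : ξ (1 - s) = ξ s := by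
  have hd : Dense ({0, 1} : Set ℂ)ᶜ := (Set.toFinite _).countable.dense_compl ℂ
  refine congrFun (Continuous.ext_on (f := fun s ↦ ξ (1 - s)) hd
    (hξ.continuous.comp (by fun_prop)) hξ.continuous fun t ht ↦ ?_) s
  simp only [Set.mem_compl_iff, Set.mem_insert_iff, Set.mem_singleton_iff, not_or] at ht
  have h0 : (1 : ℂ) - t ≠ 0 := sub_ne_zero.mpr (Ne.symm ht.2)
  have h1 : (1 : ℂ) - t ≠ 1 := by simpa using ht.1
  simp only
  rw [hξeq _ h0 h1, hξeq _ ht.1 ht.2, ← hfe]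
  ring

theorem completed_one_ne_zero {ξ Λ : ℂ → ℂ} (hξ : Differentiable ℂ ξ)
    (hξeq : ∀ s : ℂ, s ≠ 0 → s ≠ 1 → ξ s = s * (s - 1) * Λ s) {r : ℂ} (hr : r ≠ 0)
    (hlim : Tendsto (fun s : ℂ ↦ (s - 1) * Λ s) (nhdsWithin 1 {(1 : ℂ)}ᶜ) (nhds r)) :
    ξ 1 ≠ 0 := by
  have h1 : Tendsto ξ (nhdsWithin 1 {(1 : ℂ)}ᶜ) (nhds (ξ 1)) :=
    (hξ.continuous.tendsto 1).mono_left nhdsWithin_le_nhds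
  have h2 : Tendsto (fun s : ℂ ↦ s * ((s - 1) * Λ s)) (nhdsWithin 1 {(1 : ℂ)}ᶜ) (nhds (1 * r)) :=
    (tendsto_id.mono_left nhdsWithin_le_nhds).mul hlim
  have h3 : ξ 1 = 1 * r := by
    refine tendsto_nhds_unique (h1.congr' ?_) h2
    filter_upwards [self_mem_nhdsWithin,
      mem_nhdsWithin_of_mem_nhds (isOpen_ne.mem_nhds (one_ne_zero (α := ℂ)))] with s hs hs0
    rw [hξeq s hs0 hs]
    ring
  rwa [h3, one_mul]

/-- Polynomial growth of an entire completed zeta function in a vertical strip. -/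
theorem exists_norm_completed_le {ξ D G : ℂ → ℂ} {κ B : ℝ} {c w : ℂ} (hξ : Differentiable ℂ ξ)
    (hκ : 0 < κ) (hw : w ≠ 0)
    (hξD : ∀ s : ℂ, 1 < s.re → ξ s = s * (s - 1) * ((κ : ℂ) ^ s * Gamma s * D s))
    (hfe : ∀ s, ξ (1 - s) = ξ s)
    (hG : ∀ s : ℂ, 0 < s.re → s.re < 3 → DifferentiableAt ℂ G s)
    (hB : ∀ s : ℂ, 1 / 2 ≤ s.re → s.re ≤ 2 → ‖G s‖ ≤ B)
    (hGD : ∀ s : ℂ, 1 < s.re → s.re < 3 →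
      (Real.pi : ℂ) ^ (-s) * Gamma s * (w * D s) = G s + c / (s - 1)) :
    ∃ C : ℝ, ∀ s : ℂ, -1 ≤ s.re → s.re ≤ 2 → ‖ξ s‖ ≤ C * (1 + ‖s‖) ^ 2 := by
  have hpi : (Real.pi : ℂ) ≠ 0 := by exact_mod_cast Real.pi_ne_zero
  have hκ0 : (κ : ℂ) ≠ 0 := by exact_mod_cast hκ.ne'
  set H : ℂ → ℂ := fun s ↦ (κ : ℂ) ^ s * (Real.pi : ℂ) ^ s * w⁻¹ * (s * ((s - 1) * G s + c))
    with hH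
  have hU : IsOpen {s : ℂ | 0 < s.re ∧ s.re < 3} :=
    (isOpen_lt continuous_const continuous_re).inter (isOpen_lt continuous_re continuous_const)
  have hconvex : Convex ℝ {s : ℂ | 0 < s.re ∧ s.re < 3} :=
    (convex_halfSpace_re_gt 0).inter (convex_halfSpace_re_lt 3)
  have hHd : DifferentiableOn ℂ H {s : ℂ | 0 < s.re ∧ s.re < 3} := by
    intro s hs
    have h1 := hG s hs.1 hs.2
    have h2 : DifferentiableAt ℂ (fun s : ℂ ↦ (κ : ℂ) ^ s) s :=
      differentiableAt_id.const_cpow (.inl hκ0)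
    have h3 : DifferentiableAt ℂ (fun s : ℂ ↦ (Real.pi : ℂ) ^ s) s :=
      differentiableAt_id.const_cpow (.inl hpi)
    refine DifferentiableAt.differentiableWithinAt ?_
    fun_prop
  have heq : Set.EqOn ξ H {s : ℂ | 0 < s.re ∧ s.re < 3} := by
    refine AnalyticOnNhd.eqOn_of_preconnected_of_eventuallyEq (z₀ := 2)
      (hξ.differentiableOn.analyticOnNhd hU) (hHd.analyticOnNhd hU) hconvex.isPreconnected
      (by norm_num) ?_
    have h1 : {s : ℂ | 1 < s.re ∧ s.re < 3} ∈ nhds (2 : ℂ) :=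
      ((isOpen_lt continuous_const continuous_re).inter
        (isOpen_lt continuous_re continuous_const)).mem_nhds (by norm_num)
    filter_upwards [h1] with s hs
    have hs1 : s - 1 ≠ 0 := by
      intro h; have := hs.1; rw [sub_eq_zero.mp h] at this; simp at this
    have e : (s - 1) * G s + c = (s - 1) * (Real.pi ^ (-s) * Gamma s * (w * D s)) := by
      rw [hGD s hs.1 hs.2]; field_simp
    have hps : (Real.pi : ℂ) ^ s ≠ 0 := by simp [hpi]
    rw [hξD s hs.1, hH]
    simp only
    rw [e, cpow_neg]
    field_simp
  have hpos : 0 < κ * Real.pi := mul_pos hκ Real.pi_pos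
  have hright : ∀ s : ℂ, 1 / 2 ≤ s.re → s.re ≤ 2 →
      ‖ξ s‖ ≤ (1 + κ * Real.pi) ^ 2 * ‖w‖⁻¹ * (B + ‖c‖) * (1 + ‖s‖) ^ 2 := by
    intro s h1 h2
    have hBs := hB s h1 h2
    have hB0 : 0 ≤ B := (norm_nonneg _).trans hBs
    rw [heq ⟨by linarith, by linarith⟩, hH]
    simp only [norm_mul, norm_inv]
    have e1 : ‖(κ : ℂ) ^ s‖ * ‖(Real.pi : ℂ) ^ s‖ ≤ (1 + κ * Real.pi) ^ 2 := by
      rw [norm_cpow_eq_rpow_re_of_pos hκ, norm_cpow_eq_rpow_re_of_pos Real.pi_pos,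
        ← Real.mul_rpow hκ.le Real.pi_pos.le]
      calc _ ≤ (1 + κ * Real.pi) ^ s.re := by gcongr; linarith
        _ ≤ (1 + κ * Real.pi) ^ (2 : ℝ) := Real.rpow_le_rpow_of_exponent_le (by linarith) h2
        _ = _ := by norm_cast
    have e2 : ‖(s - 1) * G s + c‖ ≤ (1 + ‖s‖) * (B + ‖c‖) := by
      refine (norm_add_le _ _).trans ?_
      rw [norm_mul, mul_add]
      have h3 : ‖s - 1‖ ≤ 1 + ‖s‖ := (norm_sub_le _ _).trans (by rw [norm_one, add_comm])
      refine add_le_add (by gcongr) (le_mul_of_one_le_left (norm_nonneg _) ?_)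
      linarith [norm_nonneg s]
    calc _ ≤ (1 + κ * Real.pi) ^ 2 * ‖w‖⁻¹ * ((1 + ‖s‖) * ((1 + ‖s‖) * (B + ‖c‖))) := by
          gcongr
          linarith
      _ = _ := by ring
  set C := (1 + κ * Real.pi) ^ 2 * ‖w‖⁻¹ * (B + ‖c‖)
  have hB0 : 0 ≤ B := (norm_nonneg _).trans (hB 1 (by norm_num) (by norm_num))
  have hC0 : 0 ≤ C := by positivity
  clear_value C
  refine ⟨C * 4, fun s h1 h2 ↦ ?_⟩
  rcases le_total (1 / 2) s.re with h | h
  · refine (hright s h h2).trans ?_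
    gcongr
    linarith
  · rw [← hfe]
    refine (hright (1 - s) (by simp; linarith) (by simp; linarith)).trans ?_
    rw [mul_assoc]
    gcongr
    have h3 : ‖1 - s‖ ≤ 1 + ‖s‖ := (norm_sub_le _ _).trans (by rw [norm_one])
    calc (1 + ‖1 - s‖) ^ 2 ≤ (2 * (1 + ‖s‖)) ^ 2 := by
          gcongr; linarith [norm_nonneg s]
      _ = _ := by ring

theorem norm_completedDedekindZeta_le_shift {K : Type*} [Field K] [NumberField K]
    (hdeg : Module.finrank ℚ K = 2) (himag : ∀ v : InfinitePlace K, v.IsComplex)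
    (hclass : classNumber K = 1) {Λ ξ : ℂ → ℂ} (hΛ : IsCompletedDedekindZeta K Λ)
    (hξ : Differentiable ℂ ξ) (hξeq : ∀ s : ℂ, s ≠ 0 → s ≠ 1 → ξ s = s * (s - 1) * Λ s) :
    (∀ s : ℂ, 1 < s.re → ξ s ≠ 0) ∧ ∀ w : ℂ, 0 ≤ w.re → ‖ξ w‖ ≤ ‖ξ (1 + w)‖ := by
  obtain ⟨hsum, z, A, w₀, hA, hw₀, hE⟩ := exists_dedekindZetaSum_eq_epstein hdeg himag hclass
  obtain ⟨G, c, B, hG, hB, hGD⟩ := exists_epstein_continuation z hA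
  set κ : ℝ := Real.sqrt |(NumberField.discr K : ℝ)| / (2 * Real.pi) with hκdef
  have hκ : 0 < κ := by
    have := NumberField.discr_ne_zero K
    have := Real.pi_pos
    positivity
  have hξD : ∀ s : ℂ, 1 < s.re →
      ξ s = s * (s - 1) * ((κ : ℂ) ^ s * Gamma s * dedekindZetaSum K s) := by
    intro s hs
    rw [← hΛ.eq_on_gt_one s hs, hξeq s]
    · rintro rfl; simp at hs; linarith
    · rintro rfl; simp at hs
  have hfe := completed_functional_equation hξ hξeq hΛ.functional_equation
  have hDb : ∀ σ : ℝ, 1 < σ → ∃ M : ℝ, ∀ s : ℂ, σ ≤ s.re →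
      ‖dedekindZetaSum K s‖ ≤ M ∧ 1 / 2 ≤ ‖dedekindZetaSum K s‖ * M :=
    fun σ hσ ↦ ⟨_, fun s hs ↦ norm_dedekindZetaSum_le hσ (hsum σ hσ) hs⟩
  have hgrowth := exists_norm_completed_le hξ hκ hw₀ hξD hfe hG hB fun s h1 h3 ↦ by
    rw [← hE s h1, hGD s h1 h3]
  exact ⟨fun s hs ↦ completed_ne_zero hκ hξD hDb hs, fun w hw ↦
    norm_completed_le_shift hξ hκ hξD hfe (dedekindZetaSum_conj K) hDb hgrowth hw⟩

theorem phiK_two_sub {Λ : ℂ → ℂ} (hfe : ∀ s : ℂ, Λ s = Λ (1 - s)) (a : ℝ) (s : ℂ) :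
    phiK Λ a (2 - s) = phiK Λ a s := by
  rw [phiK, phiK, hfe (2 - s), hfe (2 - s - 1)]
  ring_nf

theorem hasDerivAt_cpow_mul_completed_div {ξ : ℂ → ℂ} (hξ : Differentiable ℂ ξ)
    (hfe : ∀ s, ξ (1 - s) = ξ s) (h1 : ξ 1 ≠ 0) {a : ℝ} (ha : 0 < a) {r : ℝ}
    (hr : (r : ℂ) = deriv ξ 0 / ξ 0) :
    HasDerivAt (fun w : ℂ ↦ (a : ℂ) ^ (-2 * w) * (ξ w / ξ (1 + w)))
      (-2 * ((Real.log a - r : ℝ) : ℂ)) 0 := by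
  have h01 : ξ 0 = ξ 1 := by rw [← hfe 0, sub_zero]
  have ha0 : (a : ℂ) ≠ 0 := by exact_mod_cast ha.ne'
  have d0 : HasDerivAt ξ (deriv ξ 0) 0 := (hξ 0).hasDerivAt
  have d1 : HasDerivAt (fun w ↦ ξ (1 + w)) (-deriv ξ 0) 0 := by
    have e : (fun w ↦ ξ (1 + w)) = fun w ↦ ξ (-w) := by
      ext w; rw [← hfe (-w), sub_neg_eq_add]
    have d0' : HasDerivAt ξ (deriv ξ 0) (-0) := by simpa using d0
    rw [e]
    simpa [Function.comp_def] using d0'.comp (0 : ℂ) (hasDerivAt_neg (0 : ℂ))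
  have d2 : HasDerivAt (fun w : ℂ ↦ (a : ℂ) ^ (-2 * w)) (-2 * (Real.log a : ℂ)) 0 := by
    have := ((hasDerivAt_id (0 : ℂ)).const_mul (-2)).const_cpow (c := (a : ℂ)) (.inl ha0)
    simpa [ofReal_log ha.le, mul_comm] using this
  have := d2.mul (d0.div d1 (by simpa using h1))
  refine this.congr_deriv ?_
  have hd : deriv ξ 0 = r * ξ 1 := by rw [hr, h01]; field_simp
  simp only [add_zero, mul_zero, cpow_zero, Pi.div_apply, h01, div_self h1]
  rw [hd]
  push_cast
  field_simp
  ring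

theorem re_le_one_of_phiK_eq_zero {Λ ξ : ℂ → ℂ} (hξ : Differentiable ℂ ξ)
    (hξeq : ∀ s : ℂ, s ≠ 0 → s ≠ 1 → ξ s = s * (s - 1) * Λ s)
    (hfe : ∀ s, ξ (1 - s) = ξ s) (h1 : ξ 1 ≠ 0) (hne : ∀ s : ℂ, 1 < s.re → ξ s ≠ 0)
    (hle : ∀ w : ℂ, 0 ≤ w.re → ‖ξ w‖ ≤ ‖ξ (1 + w)‖) {r : ℝ} (hr : (r : ℂ) = deriv ξ 0 / ξ 0)
    {a : ℝ} (ha : 1 ≤ a) (ha' : a ≤ Real.exp (1 + r)) {s : ℂ} (hs : s ≠ 2)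
    (hzero : phiK Λ a s = 0) : s.re ≤ 1 := by
  by_contra! hre
  have ha0 : (0 : ℝ) < a := by linarith
  have ha0' : (a : ℂ) ≠ 0 := by exact_mod_cast ha0.ne'
  have hne' : ∀ w : ℂ, 0 < w.re → ξ (1 + w) ≠ 0 := fun w hw ↦ hne _ (by simpa)
  have hc : Real.log a - r ≤ 1 := by
    have := (Real.log_le_iff_le_exp ha0).mpr ha'
    linarith
  have hsub : (s - 1).re = s.re - 1 := by simp
  refine ne_cayley_of_hasDerivAt_zero
    (g := fun w : ℂ ↦ (a : ℂ) ^ (-2 * w) * (ξ w / ξ (1 + w))) (w₀ := s - 1) ?_ ?_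
    (hasDerivAt_cpow_mul_completed_div hξ hfe h1 ha0 hr) ?_ hc ?_ (by rw [hsub]; linarith) ?_
  · intro w hw
    refine DifferentiableAt.differentiableWithinAt ?_
    refine DifferentiableAt.mul ?_ ((hξ w).div ((hξ _).comp w (by fun_prop)) (hne' w hw))
    exact (differentiableAt_id.const_mul (-2 : ℂ)).const_cpow (.inl ha0')
  · intro w hw
    rw [norm_mul, norm_div, norm_cpow_eq_rpow_re_of_pos ha0]
    refine mul_le_one₀ (Real.rpow_le_one_of_one_le_of_nonpos ha ?_) (by positivity)
      (div_le_one_of_le₀ (hle w hw.le) (norm_nonneg _))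
    simp; linarith
  · simp [← hfe 0, h1]
  · have := hne 2 (by norm_num)
    have e : (1 : ℂ) + 1 = 2 := by norm_num
    simp [e, h1, this, ha0']
  · have hs0 : s ≠ 0 := by rintro rfl; simp at hre; linarith
    have hs1 : s - 1 ≠ 0 := by intro h; rw [sub_eq_zero.mp h] at hre; simp at hre
    have hs2 : s - 2 ≠ 0 := sub_ne_zero.mpr hs
    have hξs := hne s hre
    have e1 := hξeq s hs0 (sub_ne_zero.mp hs1)
    have e2 := hξeq (s - 1) hs1 (by intro h; apply hs2; linear_combination h)
    have e3 : (a : ℂ) ^ (2 - s) = (a : ℂ) ^ s * (a : ℂ) ^ (-2 * (s - 1)) := by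
      rw [← cpow_add _ _ ha0']; congr 1; ring
    rw [phiK, e3, mul_assoc, ← mul_add, mul_eq_zero, or_iff_right (by simp [cpow_eq_zero_iff, ha0'])]
      at hzero
    have e4 : (1 : ℂ) + (s - 1) = s := by ring
    simp only [e4]
    rw [mul_div_assoc', div_eq_div_iff hξs hs0, e1, e2]
    linear_combination (s - 1) * (s - 2) * s * hzero

/-- If `a*_K ≥ 1` and `1 ≤ a ≤ a*_K`, where `a*_K = exp(1 + ξ_K′(0)/ξ_K(0))` with
`ξ_K(s) = s(s-1)Λ_K(s)` extended to an entire function, then every zero of `φ_K(a,·)`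
away from `0, 1, 2` lies on the critical line `Re(s) = 1`. -/
theorem phiK_all_zeros_on_line (K : Type*) [Field K] [NumberField K]
    (hdeg : Module.finrank ℚ K = 2)
    (himag : ∀ v : NumberField.InfinitePlace K, v.IsComplex)
    (hclass : NumberField.classNumber K = 1)
    (ΛK : ℂ → ℂ) (hΛ : IsCompletedDedekindZeta K ΛK)
    (ξK : ℂ → ℂ) (hξdiff : Differentiable ℂ ξK)
    (hξeq : ∀ s : ℂ, s ≠ 0 → s ≠ 1 → ξK s = s * (s - 1) * ΛK s)
    (r : ℝ) (hr : (r : ℂ) = deriv ξK 0 / ξK 0)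
    (haK : 1 ≤ Real.exp (1 + r))
    (a : ℝ) (ha : 1 ≤ a) (ha' : a ≤ Real.exp (1 + r))
    (s : ℂ) (hs : s ∉ ({0, 1, 2} : Set ℂ)) (hzero : phiK ΛK a s = 0) :
    s.re = 1 := by
  simp only [Set.mem_insert_iff, Set.mem_singleton_iff, not_or] at hs
  obtain ⟨ρ, hρ, hlim⟩ := hΛ.simple_pole_at_one
  have hfe := completed_functional_equation hξdiff hξeq hΛ.functional_equation
  have h1 := completed_one_ne_zero hξdiff hξeq hρ hlim
  obtain ⟨hne, hle⟩ := norm_completedDedekindZeta_le_shift hdeg himag hclass hΛ hξdiff hξeq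
  refine le_antisymm
    (re_le_one_of_phiK_eq_zero hξdiff hξeq hfe h1 hne hle hr ha ha' hs.2.2 hzero) ?_
  have h2 : (2 - s).re ≤ 1 :=
    re_le_one_of_phiK_eq_zero hξdiff hξeq hfe h1 hne hle hr ha ha' (by simpa using hs.1)
      ((phiK_two_sub hΛ.functional_equation a s).trans hzero)
  rw [sub_re, re_ofNat] at h2
  linarith
end

section
/- For every prime number p, every sign ε ∈ {+1, -1}, and every real number a ≥ 1, all non-real zeros of F_ε(a,·) lie on the critical line: if s ∈ ℂ satisfies Im(s) ≠ 0 and F_ε(a,s) = 0, then Re(s) = 1/2. -/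
open Complex

/-- The function `F_ε(a,s) = a^s (p^s + ε) Λ(2s) + a^{1-s} (p^{1-s} + ε) Λ(2s-1)`
arising from the scattering determinant of the Hecke group `Γ₀(p)`, where `Λ` is the
completed Riemann zeta function. -/
noncomputable def heckeF (p : ℕ) (ε : ℂ) (a : ℝ) (s : ℂ) : ℂ :=
  (a : ℂ) ^ s * ((p : ℂ) ^ s + ε) * completedRiemannZeta (2 * s) +
    (a : ℂ) ^ (1 - s) * ((p : ℂ) ^ (1 - s) + ε) * completedRiemannZeta (2 * s - 1)

open Set Filter Topology

lemma hasDerivAt_ofReal_cpow (c : ℂ) {x : ℝ} (hx : 0 < x) :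
    HasDerivAt (fun y : ℝ ↦ (y : ℂ) ^ c) (c * (x : ℂ) ^ (c - 1)) x := by
  simpa using ((hasDerivAt_id (x : ℂ)).cpow_const (c := c) (ofReal_mem_slitPlane.2 hx)).comp_ofReal

/-- Summand in the series for `(s - 1) ζ(s) - 1` that converges for `0 < re s`. -/
noncomputable def zetaTerm (n : ℕ) (s : ℂ) : ℂ :=
  (s - 1) * ((n + 1 : ℝ) : ℂ) ^ (-s) +
    (((n + 2 : ℝ) : ℂ) ^ (1 - s) - ((n + 1 : ℝ) : ℂ) ^ (1 - s))

lemma differentiable_zetaTerm (n : ℕ) : Differentiable ℂ (zetaTerm n) := by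
  have h1 : ((n + 1 : ℝ) : ℂ) ≠ 0 := by exact_mod_cast n.succ_ne_zero
  have h2 : ((n + 2 : ℝ) : ℂ) ≠ 0 := by exact_mod_cast (n + 1).succ_ne_zero
  intro s
  unfold zetaTerm
  have k1 := (differentiableAt_id (𝕜 := ℂ) (x := s)).neg.const_cpow (Or.inl h1)
  have k2 := ((differentiableAt_id (𝕜 := ℂ) (x := s)).const_sub 1).const_cpow (Or.inl h1)
  have k3 := ((differentiableAt_id (𝕜 := ℂ) (x := s)).const_sub 1).const_cpow (Or.inl h2)
  exact ((differentiableAt_id.sub_const 1).mul k1).add (k3.sub k2)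

lemma norm_zetaTerm_le (n : ℕ) {s : ℂ} (hs : 0 < s.re) :
    ‖zetaTerm n s‖ ≤ ‖s‖ * ‖s - 1‖ * (1 / (n + 1 : ℝ) ^ (s.re + 1)) := by
  set N : ℝ := n + 1 with hN
  have hNpos : 0 < N := by positivity
  have hpos : ∀ x ∈ Icc N (N + 1), 0 < x := fun x hx ↦ hNpos.trans_le hx.1
  have hl : N ∈ Icc N (N + 1) := ⟨le_rfl, by linarith⟩
  have hr : N + 1 ∈ Icc N (N + 1) := ⟨by linarith, le_rfl⟩
  set C := ‖s‖ * ‖s - 1‖ * (1 / N ^ (s.re + 1)) with hC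
  have hC0 : 0 ≤ C := by positivity
  have hsecond : ∀ x ∈ Icc N (N + 1),
      ‖(1 - s) * (x : ℂ) ^ (1 - s - 1) - (1 - s) * (N : ℂ) ^ (1 - s - 1)‖ ≤ C := by
    intro x hx
    have := (convex_Icc N (N + 1)).norm_image_sub_le_of_norm_hasDerivWithin_le (C := C)
      (f := fun y : ℝ ↦ (1 - s) * (y : ℂ) ^ (1 - s - 1))
      (fun y hy ↦ ((hasDerivAt_ofReal_cpow (1 - s - 1) (hpos y hy)).const_mul
        (1 - s)).hasDerivWithinAt)
      (fun y hy ↦ ?_) hl hx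
    · refine this.trans (mul_le_of_le_one_right hC0 ?_)
      rw [Real.norm_eq_abs, abs_of_nonneg (by linarith [hx.1])]
      linarith [hx.2]
    · have hy0 := hpos y hy
      rw [norm_mul, norm_mul, norm_cpow_eq_rpow_re_of_pos hy0,
        show 1 - s - 1 = -s by ring, norm_neg, norm_sub_rev 1 s]
      have h3 : y ^ (-s - 1).re ≤ 1 / N ^ (s.re + 1) := by
        rw [show (-s - 1).re = -(s.re + 1) by simp; ring, Real.rpow_neg hy0.le, one_div]
        gcongr
        exact hy.1
      calc _ = ‖s‖ * ‖s - 1‖ * y ^ (-s - 1).re := by ring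
        _ ≤ _ := by rw [hC]; gcongr
  have := (convex_Icc N (N + 1)).norm_image_sub_le_of_norm_hasDerivWithin_le (C := C)
      (f := fun y : ℝ ↦ (y : ℂ) ^ (1 - s) - y * ((1 - s) * (N : ℂ) ^ (1 - s - 1)))
      (fun y hy ↦ ((hasDerivAt_ofReal_cpow (1 - s) (hpos y hy)).sub
        ((hasDerivAt_id (y : ℂ)).comp_ofReal.mul_const _)).hasDerivWithinAt)
      (fun y hy ↦ by simpa using hsecond y hy) hl hr
  have e : zetaTerm n s = ((N + 1 : ℝ) : ℂ) ^ (1 - s) -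
      (N + 1 : ℝ) * ((1 - s) * (N : ℂ) ^ (1 - s - 1)) -
      ((N : ℂ) ^ (1 - s) - N * ((1 - s) * (N : ℂ) ^ (1 - s - 1))) := by
    rw [zetaTerm, ← hN, show (n + 2 : ℝ) = N + 1 by rw [hN]; ring, show 1 - s - 1 = -s by ring]
    push_cast
    ring
  rw [e]
  simpa using this

lemma summable_one_div_nat_add_one_rpow {r : ℝ} (hr : 1 < r) :
    Summable fun n : ℕ ↦ 1 / (n + 1 : ℝ) ^ r := by
  have := (summable_nat_add_iff 1).2 (Real.summable_one_div_nat_rpow.2 hr)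
  simpa using this

lemma tsum_one_div_nat_add_one_rpow_le {r : ℝ} (hr : 0 < r) :
    ∑' n : ℕ, 1 / (n + 1 : ℝ) ^ (r + 1) ≤ 1 + 1 / r := by
  have h := ZetaAsymptotics.zeta_limit_aux1 (s := r + 1) (by linarith)
  have h2 : 0 ≤ ZetaAsymptotics.termTSum (r + 1) :=
    tsum_nonneg fun n ↦ ZetaAsymptotics.term_nonneg _ _
  have h3 : 0 ≤ (r + 1) * ZetaAsymptotics.termTSum (r + 1) := by positivity
  rw [add_sub_cancel_right] at h
  linarith

lemma riemannZeta₁_eq_of_one_lt_re {s : ℂ} (hs : 1 < s.re) :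
    riemannZeta₁ s = 1 + ∑' n, zetaTerm n s := by
  have hs1 : s ≠ 1 := by rintro rfl; simp at hs
  have hA : Summable fun n : ℕ ↦ (s - 1) * ((n + 1 : ℝ) : ℂ) ^ (-s) := by
    refine Summable.mul_left _ (Summable.of_norm ?_)
    refine (summable_one_div_nat_add_one_rpow hs).congr fun n ↦ ?_
    rw [norm_cpow_eq_rpow_re_of_pos (by positivity), neg_re, Real.rpow_neg (by positivity), one_div]
  have hT : Summable fun n ↦ zetaTerm n s := by
    refine Summable.of_norm_bounded
      ((summable_one_div_nat_add_one_rpow (r := s.re + 1) (by linarith)).mul_left (‖s‖ * ‖s - 1‖))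
      fun n ↦ norm_zetaTerm_le n (by linarith)
  have hB : Summable fun n : ℕ ↦ ((n + 2 : ℝ) : ℂ) ^ (1 - s) - ((n + 1 : ℝ) : ℂ) ^ (1 - s) := by
    refine (hT.sub hA).congr fun n ↦ ?_
    simp [zetaTerm]
  have hB2 : ∑' n : ℕ, (((n + 2 : ℝ) : ℂ) ^ (1 - s) - ((n + 1 : ℝ) : ℂ) ^ (1 - s)) = -1 := by
    refine tendsto_nhds_unique hB.hasSum.tendsto_sum_nat ?_
    have e : ∀ N : ℕ, ∑ n ∈ Finset.range N,
        (((n + 2 : ℝ) : ℂ) ^ (1 - s) - ((n + 1 : ℝ) : ℂ) ^ (1 - s)) =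
        ((N + 1 : ℝ) : ℂ) ^ (1 - s) - 1 := by
      intro N
      have := Finset.sum_range_sub (fun n : ℕ ↦ ((n + 1 : ℝ) : ℂ) ^ (1 - s)) N
      simp only [Nat.cast_zero, zero_add, ofReal_one, one_cpow] at this
      rw [← this]
      refine Finset.sum_congr rfl fun n _ ↦ ?_
      push_cast
      ring_nf
    simp_rw [e]
    rw [← zero_sub (1 : ℂ)]
    refine Tendsto.sub_const ?_ 1
    rw [tendsto_zero_iff_norm_tendsto_zero]
    have h0 := (tendsto_rpow_neg_atTop (y := s.re - 1) (by linarith)).comp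
      (tendsto_atTop_add_const_right _ (1 : ℝ) tendsto_natCast_atTop_atTop)
    refine h0.congr fun n ↦ ?_
    simp only [Function.comp]
    rw [norm_cpow_eq_rpow_re_of_pos (by positivity)]
    simp
  have hsum : ∑' n, zetaTerm n s = (s - 1) * riemannZeta s - 1 := by
    simp only [zetaTerm]
    have e : ∑' n : ℕ, ((n + 1 : ℝ) : ℂ) ^ (-s) = ∑' n : ℕ, 1 / (n + 1 : ℂ) ^ s := by
      refine tsum_congr fun n ↦ ?_
      rw [cpow_neg, one_div]
      push_cast
      rfl
    rw [hA.tsum_add hB, hB2, tsum_mul_left, zeta_eq_tsum_one_div_nat_add_one_cpow hs, e]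
    ring
  rw [hsum, riemannZeta_eq_inv_sub_mul hs1]
  have := sub_ne_zero.2 hs1
  field_simp
  ring

lemma riemannZeta₁_eq_of_re_pos {s : ℂ} (hs : 0 < s.re) :
    riemannZeta₁ s = 1 + ∑' n, zetaTerm n s := by
  set R : ℝ := ‖s‖ + 3
  set δ : ℝ := min (s.re / 2) 1
  have hδ : 0 < δ := lt_min (by linarith) one_pos
  set U : Set ℂ := {z | δ < z.re} ∩ Metric.ball 0 R
  have hUo : IsOpen U := (isOpen_lt continuous_const continuous_re).inter Metric.isOpen_ball
  have hUc : IsPreconnected U :=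
    ((convex_halfSpace_re_gt δ).inter (convex_ball 0 R)).isPreconnected
  have hdiff : DifferentiableOn ℂ (fun z ↦ ∑' n, zetaTerm n z) U := by
    refine differentiableOn_tsum_of_summable_norm
      ((summable_one_div_nat_add_one_rpow (r := δ + 1) (by linarith)).mul_left (R * (R + 1)))
      (fun n ↦ (differentiable_zetaTerm n).differentiableOn) hUo fun n z hz ↦ ?_
    have hz1 : δ < z.re := hz.1
    have hz2 : ‖z‖ < R := by simpa using hz.2
    refine (norm_zetaTerm_le n (hδ.trans hz1)).trans ?_
    have h3 : ‖z - 1‖ ≤ R + 1 := (norm_sub_le _ _).trans (by simp; linarith)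
    have h4 : (1 : ℝ) ≤ n + 1 := by simp
    gcongr
  have h2 : (2 : ℂ) ∈ U := by
    refine ⟨?_, ?_⟩
    · have : δ ≤ 1 := min_le_right _ _
      simp only [mem_ofPred_eq, re_ofNat]
      linarith
    · simp only [Metric.mem_ball, dist_zero_right, norm_ofNat]
      linarith [norm_nonneg s]
  have hsU : s ∈ U := by
    refine ⟨?_, ?_⟩
    · have : δ ≤ s.re / 2 := min_le_left _ _
      simp only [mem_ofPred_eq]
      linarith
    · simp only [Metric.mem_ball, dist_zero_right]
      linarith
  refine ((differentiable_riemannZeta₁.differentiableOn).analyticOnNhd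
    hUo).eqOn_of_preconnected_of_eventuallyEq ((hdiff.const_add 1).analyticOnNhd hUo) hUc h2 ?_ hsU
  filter_upwards [(isOpen_lt continuous_const continuous_re).mem_nhds
    (show (1 : ℝ) < (2 : ℂ).re by simp)] with z hz
  exact riemannZeta₁_eq_of_one_lt_re hz

lemma norm_riemannZeta₁_le {s : ℂ} (hs : 0 < s.re) :
    ‖riemannZeta₁ s‖ ≤ 1 + ‖s‖ * ‖s - 1‖ * (1 + 1 / s.re) := by
  rw [riemannZeta₁_eq_of_re_pos hs]
  refine (norm_add_le _ _).trans ?_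
  rw [norm_one]
  gcongr
  have hS := (summable_one_div_nat_add_one_rpow (r := s.re + 1) (by linarith)).mul_left
    (‖s‖ * ‖s - 1‖)
  refine (tsum_of_norm_bounded hS.hasSum fun n ↦ norm_zetaTerm_le n hs).trans ?_
  rw [tsum_mul_left]
  gcongr
  exact tsum_one_div_nat_add_one_rpow_le hs

open scoped ArithmeticFunction.Moebius in
lemma norm_inv_riemannZeta_le {s : ℂ} (hs : 0 < s.re) :
    ‖(riemannZeta (s + 1))⁻¹‖ ≤ 1 + 1 / s.re := by
  have hs1 : 1 < (s + 1).re := by simpa using hs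
  have h := LSeries_one_mul_Lseries_moebius hs1
  rw [LSeries_one_eq_riemannZeta hs1] at h
  rw [← eq_inv_of_mul_eq_one_right h, LSeries]
  refine le_trans ?_ (tsum_one_div_nat_add_one_rpow_le hs)
  have hS : Summable fun n : ℕ ↦ 1 / (n : ℝ) ^ (s.re + 1) :=
    Real.summable_one_div_nat_rpow.2 (by linarith)
  have e : ∑' n : ℕ, 1 / (n + 1 : ℝ) ^ (s.re + 1) = ∑' n : ℕ, 1 / (n : ℝ) ^ (s.re + 1) := by
    rw [hS.tsum_eq_zero_add]
    have : s.re + 1 ≠ 0 := by linarith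
    simp [Real.zero_rpow this]
  rw [e]
  refine tsum_of_norm_bounded hS.hasSum fun n ↦ ?_
  rw [LSeries.norm_term_eq]
  split_ifs with hn
  · positivity
  · simp only [add_re, one_re]
    gcongr
    have := ArithmeticFunction.abs_moebius_le_one (n := n)
    rw [Complex.norm_intCast]
    exact_mod_cast this

lemma exists_norm_betaIntegral_half_le :
    ∃ M : ℝ, 0 ≤ M ∧ ∀ s : ℂ, 1 ≤ s.re → ‖betaIntegral s (1 / 2)‖ ≤ M := by
  have hint : IntervalIntegrable
      (fun x : ℝ ↦ (x : ℂ) ^ ((1 : ℂ) - 1) * (1 - (x : ℂ)) ^ ((1 / 2 : ℂ) - 1))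
      MeasureTheory.volume 0 1 := betaIntegral_convergent (by simp) (by simp)
  refine ⟨∫ x in (0 : ℝ)..1, ‖(x : ℂ) ^ ((1 : ℂ) - 1) * (1 - (x : ℂ)) ^ ((1 / 2 : ℂ) - 1)‖,
    intervalIntegral.integral_nonneg zero_le_one fun _ _ ↦ norm_nonneg _, fun s hs ↦ ?_⟩
  refine intervalIntegral.norm_integral_le_of_norm_le zero_le_one
    (Eventually.of_forall fun x hx ↦ ?_) hint.norm
  rw [norm_mul, norm_mul]
  gcongr
  rw [norm_cpow_eq_rpow_re_of_pos hx.1, sub_self, cpow_zero, norm_one]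
  exact Real.rpow_le_one hx.1.le hx.2 (by simpa using hs)

/-- The entire function `s (s - 1) Λ(s)`, where `Λ` is the completed Riemann zeta function. -/
noncomputable def entireXi (s : ℂ) : ℂ := s * (s - 1) * completedRiemannZeta₀ s + 1

lemma differentiable_entireXi : Differentiable ℂ entireXi :=
  ((differentiable_id.mul (differentiable_id.sub_const 1)).mul
    differentiable_completedZeta₀).add_const 1

lemma entireXi_one_sub (s : ℂ) : entireXi (1 - s) = entireXi s := by
  rw [entireXi, entireXi, completedRiemannZeta₀_one_sub]
  ring

lemma entireXi_eq {s : ℂ} (h0 : s ≠ 0) (h1 : s ≠ 1) :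
    entireXi s = s * (s - 1) * completedRiemannZeta s := by
  have : 1 - s ≠ 0 := sub_ne_zero.2 h1.symm
  rw [entireXi, completedRiemannZeta_eq]
  field_simp
  ring

lemma entireXi_eq_mul_riemannZeta {s : ℂ} (hs : 0 < s.re) (h1 : s ≠ 1) :
    entireXi s = s * (s - 1) * (Gammaℝ s * riemannZeta s) := by
  have h0 : s ≠ 0 := by rintro rfl; simp at hs
  rw [entireXi_eq h0 h1, riemannZeta_def_of_ne_zero h0,
    mul_div_cancel₀ _ (Gammaℝ_ne_zero_of_re_pos hs)]

@[simp] lemma entireXi_one : entireXi 1 = 1 := by simp [entireXi]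

lemma entireXi_ne_zero {s : ℂ} (hs : 1 ≤ s.re) : entireXi s ≠ 0 := by
  rcases eq_or_ne s 1 with rfl | h1
  · simp
  have hs0 : 0 < s.re := by linarith
  have h0 : s ≠ 0 := by rintro rfl; simp at hs0
  rw [entireXi_eq_mul_riemannZeta hs0 h1]
  exact mul_ne_zero (mul_ne_zero h0 (sub_ne_zero.2 h1))
    (mul_ne_zero (Gammaℝ_ne_zero_of_re_pos hs0) (riemannZeta_ne_zero_of_one_le_re hs))

lemma Gammaℝ_conj (s : ℂ) : Gammaℝ (starRingEnd ℂ s) = starRingEnd ℂ (Gammaℝ s) := by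
  have hπ : (Real.pi : ℂ).arg ≠ Real.pi := by
    rw [arg_ofReal_of_nonneg Real.pi_pos.le]
    exact Real.pi_pos.ne
  rw [Gammaℝ_def, Gammaℝ_def, map_mul, ← Gamma_conj]
  have := cpow_conj (Real.pi : ℂ) (-s / 2) hπ
  rw [conj_ofReal] at this
  simp only [map_div₀, map_neg, map_ofNat] at this ⊢
  rw [this]

lemma entireXi_conj {s : ℂ} (hs : 0 < s.re) :
    entireXi (starRingEnd ℂ s) = starRingEnd ℂ (entireXi s) := by
  rcases eq_or_ne s 1 with rfl | h1
  · simp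
  have h1' : starRingEnd ℂ s ≠ 1 := fun h ↦ h1 (by simpa using congrArg (starRingEnd ℂ) h)
  rw [entireXi_eq_mul_riemannZeta (by simpa using hs) h1', entireXi_eq_mul_riemannZeta hs h1,
    Gammaℝ_conj, riemannZeta_conj]
  simp

lemma norm_entireXi_add_one {s : ℂ} (hs : s.re = 0) : ‖entireXi (s + 1)‖ = ‖entireXi s‖ := by
  have h : starRingEnd ℂ (s + 1) = 1 - s := by
    apply Complex.ext <;> simp [hs]
  rw [← entireXi_one_sub s, ← h, entireXi_conj (by simp [hs]), norm_conj]

lemma entireXi_div_eq {s : ℂ} (hs : 0 < s.re) (h1 : s ≠ 1) :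
    entireXi s / entireXi (s + 1) =
      betaIntegral (s / 2 + 1) (1 / 2) * (riemannZeta₁ s / s) * (riemannZeta (s + 1))⁻¹ := by
  have h0 : s ≠ 0 := by rintro rfl; simp at hs
  have h2 : s + 1 ≠ 0 := fun h ↦ by
    have := congrArg re h
    simp at this
    linarith
  have hz : riemannZeta (s + 1) ≠ 0 :=
    riemannZeta_ne_zero_of_one_le_re (by simpa using hs.le)
  have hG : Gamma ((s + 1) / 2) ≠ 0 := Gamma_ne_zero_of_re_pos (by
    simp only [div_ofNat_re, add_re, one_re]; linarith)
  have hpi : (Real.pi : ℂ) ≠ 0 := ofReal_ne_zero.2 Real.pi_ne_zero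
  have hpi2 : (Real.pi : ℂ) ^ (1 / 2 : ℂ) ≠ 0 := by simp [hpi]
  have hB := Gamma_mul_Gamma_eq_betaIntegral (s := s / 2 + 1) (t := 1 / 2)
    (by simp only [add_re, div_ofNat_re, one_re]; linarith) (by simp)
  rw [Gamma_one_half_eq, Gamma_add_one _ (div_ne_zero h0 two_ne_zero),
    show s / 2 + 1 + 1 / 2 = (s + 1) / 2 + 1 by ring,
    Gamma_add_one _ (div_ne_zero h2 two_ne_zero)] at hB
  have hGs : Gamma (s / 2) = (s + 1) / s * Gamma ((s + 1) / 2) *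
      betaIntegral (s / 2 + 1) (1 / 2) / (Real.pi : ℂ) ^ (1 / 2 : ℂ) := by
    rw [eq_div_iff hpi2]
    field_simp at hB ⊢
    linear_combination hB
  have hp : (Real.pi : ℂ) ^ (-s / 2) =
      (Real.pi : ℂ) ^ (-(s + 1) / 2) * (Real.pi : ℂ) ^ (1 / 2 : ℂ) := by
    rw [← cpow_add _ _ hpi]
    congr 1
    ring
  have hp0 : (Real.pi : ℂ) ^ (-(s + 1) / 2) ≠ 0 := by simp [hpi]
  have hs1 := sub_ne_zero.2 h1
  rw [entireXi_eq_mul_riemannZeta hs h1, entireXi_eq_mul_riemannZeta (by simp; linarith)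
    (by simpa using h0), Gammaℝ_def, Gammaℝ_def, hGs, riemannZeta_eq_inv_sub_mul h1, hp,
    add_sub_cancel_right]
  field_simp

lemma exists_norm_entireXi_div_le : ∃ C : ℝ, 0 ≤ C ∧ ∀ s : ℂ, 0 < s.re → 1 < ‖s‖ →
    ‖entireXi s / entireXi (s + 1)‖ ≤ C * (1 + 1 / s.re) ^ 2 * (‖s‖ + 2) := by
  obtain ⟨M, hM0, hM⟩ := exists_norm_betaIntegral_half_le
  refine ⟨M, hM0, fun s hs hs1 ↦ ?_⟩
  have h1 : s ≠ 1 := by rintro rfl; simp at hs1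
  have hn : 0 < ‖s‖ := by linarith
  have hq : (0 : ℝ) ≤ 1 / s.re := by positivity
  have hz : ‖riemannZeta₁ s / s‖ ≤ (1 + 1 / s.re) * (‖s‖ + 2) := by
    have h3 : ‖s - 1‖ ≤ ‖s‖ + 1 := (norm_sub_le _ _).trans (by simp)
    rw [norm_div, div_le_iff₀ hn]
    calc _ ≤ 1 + ‖s‖ * ‖s - 1‖ * (1 + 1 / s.re) := norm_riemannZeta₁_le hs
      _ ≤ 1 + ‖s‖ * (‖s‖ + 1) * (1 + 1 / s.re) := by gcongr
      _ ≤ _ := by nlinarith [mul_nonneg hq hn.le]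
  rw [entireXi_div_eq hs h1, norm_mul, norm_mul]
  calc _ ≤ M * ((1 + 1 / s.re) * (‖s‖ + 2)) * (1 + 1 / s.re) := by
        gcongr
        · exact hM _ (by simp only [add_re, div_ofNat_re, one_re]; linarith)
        · exact norm_inv_riemannZeta_le hs
    _ = _ := by ring

/-- A Phragmén–Lindelöf principle in the right half-plane for functions of polynomial growth whose
bound may blow up quadratically at the imaginary axis. -/
lemma norm_le_one_of_re_pos_of_growth {f : ℂ → ℂ} (hf : DiffContOnCl ℂ f {z | 0 < z.re})
    (hb : ∀ z : ℂ, z.re = 0 → ‖f z‖ ≤ 1) {C : ℝ} (hC : 0 ≤ C)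
    (hg : ∀ z : ℂ, 0 < z.re → 1 < ‖z‖ → ‖f z‖ ≤ C * (1 + 1 / z.re) ^ 2 * (‖z‖ + 2))
    {z : ℂ} (hz : 0 < z.re) : ‖f z‖ ≤ 1 := by
  have key : ∀ ε : ℝ, 0 < ε → ∀ R : ℝ, 1 < R → ‖z‖ < R → 16 * C * (R + 2) ≤ (ε * R) ^ 2 →
      ‖f z‖ * ‖1 + z ^ 2 / R ^ 2‖ ^ 2 ≤ ‖1 + ε * z‖ ^ 2 := by
    intro ε hε R hR hzR hRC
    have hR0 : 0 < R := by linarith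
    set U : Set ℂ := {z | 0 < z.re} ∩ Metric.ball 0 R with hU
    have hcl : ∀ w ∈ closure U, 0 ≤ w.re ∧ ‖w‖ ≤ R := by
      intro w hw
      refine closure_minimal (t := {w : ℂ | 0 ≤ w.re ∧ ‖w‖ ≤ R}) (fun w hw ↦ ?_) ?_ hw
      · exact ⟨le_of_lt hw.1, (mem_ball_zero_iff.1 hw.2).le⟩
      · exact (isClosed_le continuous_const continuous_re).inter
          (isClosed_le continuous_norm continuous_const)
    have hne : ∀ w : ℂ, 0 ≤ w.re → 1 ≤ ‖1 + ε * w‖ ∧ ε * ‖w‖ ≤ ‖1 + ε * w‖ := by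
      intro w hw
      have hεw : 0 ≤ ε * w.re := by positivity
      constructor
      · refine le_trans ?_ (re_le_norm _)
        simpa using hεw
      · rw [← abs_of_nonneg (by positivity : 0 ≤ ε * ‖w‖),
          ← abs_of_nonneg (norm_nonneg (1 + ε * w)), ← sq_le_sq]
        rw [mul_pow, Complex.sq_norm, Complex.sq_norm, normSq_apply, normSq_apply]
        simp
        nlinarith
    have hne' : ∀ w : ℂ, 0 ≤ w.re → (1 + ε * w) ^ 2 ≠ 0 := fun w hw ↦
      pow_ne_zero 2 (norm_pos_iff.1 (by linarith [(hne w hw).1]))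
    have hd : DiffContOnCl ℂ
        (fun w ↦ f w * (1 + w ^ 2 / R ^ 2) ^ 2 * ((1 + ε * w) ^ 2)⁻¹) U := by
      have hfU : DiffContOnCl ℂ f U := hf.mono inter_subset_left
      have h1 : DiffContOnCl ℂ (fun w : ℂ ↦ (1 + w ^ 2 / (R : ℂ) ^ 2) ^ 2) U :=
        Differentiable.diffContOnCl (by fun_prop)
      have h2 : DiffContOnCl ℂ (fun w : ℂ ↦ ((1 + ε * w) ^ 2)⁻¹) U :=
        DiffContOnCl.inv (Differentiable.diffContOnCl (by fun_prop))
          fun w hw ↦ hne' w (hcl w hw).1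
      exact (hfU.smul h1).smul h2
    have hUo : IsOpen U := (isOpen_lt continuous_const continuous_re).inter Metric.isOpen_ball
    have hmax := norm_le_of_forall_mem_frontier_norm_le
      (Metric.isBounded_ball.subset inter_subset_right) hd (C := 1) (fun w hw ↦ ?_)
      (subset_closure (show z ∈ U from ⟨hz, by simpa using hzR⟩))
    · rw [norm_mul, norm_mul, norm_inv, norm_pow, norm_pow, ← div_eq_mul_inv, div_le_one₀] at hmax
      · exact hmax
      · have := (hne z hz.le).1
        positivity
    · obtain ⟨hwcl, hwU⟩ := hw
      rw [hUo.interior_eq] at hwU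
      obtain ⟨hw0, hwR⟩ := hcl w hwcl
      obtain ⟨hn1, hn2⟩ := hne w hw0
      have hn0 : 0 < ‖1 + ε * w‖ := by linarith
      rw [norm_mul, norm_mul, norm_inv, norm_pow, norm_pow, ← div_eq_mul_inv,
        div_le_one₀ (by positivity)]
      rcases hw0.eq_or_lt with h0 | h0
      · have hle : ‖1 + w ^ 2 / (R : ℂ) ^ 2‖ ≤ 1 := by
          have hwim : w = w.im * I := by apply Complex.ext <;> simp [← h0]
          have him : |w.im| ≤ R := (abs_im_le_norm w).trans hwR
          have hsq : w.im ^ 2 / R ^ 2 ≤ 1 := by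
            rw [div_le_one₀ (by positivity), ← sq_abs]
            gcongr
          have : 1 + w ^ 2 / (R : ℂ) ^ 2 = ((1 - w.im ^ 2 / R ^ 2 : ℝ) : ℂ) := by
            rw [hwim, mul_pow, I_sq]
            push_cast
            simp
            ring
          rw [this, Complex.norm_real, Real.norm_eq_abs, abs_of_nonneg (by linarith)]
          have : 0 ≤ w.im ^ 2 / R ^ 2 := by positivity
          linarith
        calc ‖f w‖ * ‖1 + w ^ 2 / (R : ℂ) ^ 2‖ ^ 2 ≤ 1 * 1 ^ 2 := by
              gcongr
              exact hb w h0.symm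
          _ ≤ _ := by nlinarith
      · have hwR' : ‖w‖ = R := by
          refine le_antisymm hwR (not_lt.1 fun h ↦ hwU ⟨h0, by simpa using h⟩)
        have hnorm : ‖1 + w ^ 2 / (R : ℂ) ^ 2‖ = 2 * w.re / R := by
          have hc : w * starRingEnd ℂ w = (R : ℂ) ^ 2 := by
            rw [mul_conj, ← Complex.sq_norm, hwR']
            push_cast
            rfl
          have hRc : (R : ℂ) ≠ 0 := ofReal_ne_zero.2 hR0.ne'
          have : 1 + w ^ 2 / (R : ℂ) ^ 2 = w * ((2 * w.re : ℝ) : ℂ) / (R : ℂ) ^ 2 := by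
            rw [← add_conj w]
            field_simp
            rw [← hc]
            ring
          rw [this, norm_div, norm_mul, hwR', norm_pow, Complex.norm_real, Complex.norm_real,
            Real.norm_of_nonneg hR0.le, Real.norm_of_nonneg (by positivity)]
          field_simp
        have hre : w.re ≤ R := (re_le_norm w).trans hwR
        rw [hnorm]
        calc ‖f w‖ * (2 * w.re / R) ^ 2
            ≤ C * (1 + 1 / w.re) ^ 2 * (‖w‖ + 2) * (2 * w.re / R) ^ 2 := by
              gcongr
              exact hg w h0 (by rw [hwR']; exact hR)
          _ = C * (R + 2) * (2 * (w.re + 1) / R) ^ 2 := by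
              rw [hwR']
              field_simp
          _ ≤ C * (R + 2) * 4 ^ 2 := by
              gcongr
              rw [div_le_iff₀ hR0]
              linarith
          _ = 16 * C * (R + 2) := by ring
          _ ≤ (ε * R) ^ 2 := hRC
          _ ≤ _ := by
              rw [hwR'] at hn2
              gcongr
  have hlim : ∀ ε : ℝ, 0 < ε → ‖f z‖ ≤ ‖1 + ε * z‖ ^ 2 := by
    intro ε hε
    have hinv : Tendsto (fun R : ℝ ↦ (R : ℂ)⁻¹) atTop (𝓝 0) := by
      have := (continuous_ofReal.tendsto 0).comp tendsto_inv_atTop_zero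
      simpa [Function.comp_def] using this
    have ht : Tendsto (fun R : ℝ ↦ ‖f z‖ * ‖1 + z ^ 2 / R ^ 2‖ ^ 2) atTop
        (𝓝 (‖f z‖ * ‖1 + z ^ 2 * (0 : ℂ) ^ 2‖ ^ 2)) := by
      simp only [div_eq_mul_inv, ← inv_pow]
      exact (((hinv.pow 2).const_mul _).const_add 1).norm.pow 2 |>.const_mul _
    rw [show ‖f z‖ * ‖1 + z ^ 2 * (0 : ℂ) ^ 2‖ ^ 2 = ‖f z‖ by simp] at ht
    refine le_of_tendsto ht ?_
    filter_upwards [eventually_gt_atTop 1, eventually_gt_atTop ‖z‖,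
      eventually_ge_atTop (48 * C / ε ^ 2)] with R h1 h2 h3
    refine key ε hε R h1 h2 ?_
    rw [div_le_iff₀ (by positivity)] at h3
    calc 16 * C * (R + 2) ≤ 16 * C * (3 * R) := by gcongr; linarith
      _ = 48 * C * R := by ring
      _ ≤ R * ε ^ 2 * R := by gcongr
      _ = _ := by ring
  have ht : Tendsto (fun ε : ℝ ↦ ‖1 + (ε : ℂ) * z‖ ^ 2) (𝓝[>] 0) (𝓝 1) := by
    have : Continuous fun ε : ℝ ↦ ‖1 + (ε : ℂ) * z‖ ^ 2 := by fun_prop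
    simpa using (this.tendsto 0).mono_left nhdsWithin_le_nhds
  exact ge_of_tendsto ht (eventually_mem_nhdsWithin.mono fun ε hε ↦ hlim ε hε)

/-- The involutive automorphism of the unit disc that exchanges `c` and `0`. -/
noncomputable def discInvolution (c w : ℂ) : ℂ := (c - w) / (1 - starRingEnd ℂ c * w)

lemma one_sub_conj_mul_ne_zero_s17 {c w : ℂ} (hc : ‖c‖ < 1) (hw : ‖w‖ < 1) :
    1 - starRingEnd ℂ c * w ≠ 0 := by
  intro h
  have h2 : ‖starRingEnd ℂ c * w‖ = 1 := by rw [← sub_eq_zero.1 h, norm_one]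
  rw [norm_mul, norm_conj] at h2
  nlinarith [norm_nonneg c, norm_nonneg w]

lemma norm_discInvolution_lt_one {c w : ℂ} (hc : ‖c‖ < 1) (hw : ‖w‖ < 1) :
    ‖discInvolution c w‖ < 1 := by
  rw [discInvolution, norm_div,
    div_lt_one (norm_pos_iff.2 (one_sub_conj_mul_ne_zero_s17 hc hw))]
  refine lt_of_pow_lt_pow_left₀ 2 (norm_nonneg _) ?_
  have h1 : ‖c‖ ^ 2 < 1 := by nlinarith [norm_nonneg c]
  have h2 : ‖w‖ ^ 2 < 1 := by nlinarith [norm_nonneg w]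
  rw [Complex.sq_norm, normSq_apply] at h1 h2
  rw [Complex.sq_norm, Complex.sq_norm, normSq_apply, normSq_apply]
  simp
  nlinarith [mul_pos (sub_pos.2 h1) (sub_pos.2 h2)]

lemma discInvolution_discInvolution {c w : ℂ} (hc : ‖c‖ < 1) (hw : ‖w‖ < 1) :
    discInvolution c (discInvolution c w) = w := by
  have h1 := one_sub_conj_mul_ne_zero_s17 hc hw
  have h3 := one_sub_conj_mul_ne_zero_s17 hc (norm_discInvolution_lt_one hc hw)
  have e : discInvolution c w * (1 - starRingEnd ℂ c * w) = c - w := div_mul_cancel₀ _ h1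
  rw [discInvolution, div_eq_iff h3]
  linear_combination (-1 : ℂ) * e

@[simp] lemma discInvolution_self (c : ℂ) : discInvolution c c = 0 := by simp [discInvolution]

@[simp] lemma discInvolution_zero (c : ℂ) : discInvolution c 0 = c := by simp [discInvolution]

lemma differentiableOn_discInvolution {c : ℂ} (hc : ‖c‖ < 1) :
    DifferentiableOn ℂ (discInvolution c) (Metric.ball 0 1) := by
  unfold discInvolution
  refine DifferentiableOn.div (by fun_prop) (by fun_prop) fun w hw ↦ ?_
  exact one_sub_conj_mul_ne_zero_s17 hc (mem_ball_zero_iff.1 hw)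

lemma eqOn_id_of_map_zero_of_fixed {g : ℂ → ℂ} (hd : DifferentiableOn ℂ g (Metric.ball 0 1))
    (hm : MapsTo g (Metric.ball 0 1) (Metric.ball 0 1)) (h0 : g 0 = 0) {b : ℂ}
    (hb : b ∈ Metric.ball (0 : ℂ) 1) (hb0 : b ≠ 0) (hgb : g b = b) :
    EqOn g id (Metric.ball 0 1) := by
  have hs : dslope g 0 b = 1 := by
    rw [dslope_of_ne _ hb0, slope_def_field, h0, hgb, sub_zero, div_self hb0]
  have := affine_of_mapsTo_ball_of_norm_dslope_eq_div (R₂ := 1) hd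
    (by rw [h0]; exact hm.mono_right Metric.ball_subset_closedBall) hb (by simp [hs])
  intro w hw
  simpa [h0, hs] using this hw

/-- A holomorphic self-map of the unit disc with two fixed points is the identity. -/
lemma eqOn_id_of_two_fixed_points {g : ℂ → ℂ} (hd : DifferentiableOn ℂ g (Metric.ball 0 1))
    (hm : MapsTo g (Metric.ball 0 1) (Metric.ball 0 1)) {a b : ℂ}
    (ha : a ∈ Metric.ball (0 : ℂ) 1) (hb : b ∈ Metric.ball (0 : ℂ) 1) (hab : a ≠ b)
    (hga : g a = a) (hgb : g b = b) : EqOn g id (Metric.ball 0 1) := by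
  have ha' := mem_ball_zero_iff.1 ha
  have hφ : MapsTo (discInvolution a) (Metric.ball 0 1) (Metric.ball 0 1) := fun w hw ↦
    mem_ball_zero_iff.2 (norm_discInvolution_lt_one ha' (mem_ball_zero_iff.1 hw))
  have hinv : ∀ w ∈ Metric.ball (0 : ℂ) 1, discInvolution a (discInvolution a w) = w :=
    fun w hw ↦ discInvolution_discInvolution ha' (mem_ball_zero_iff.1 hw)
  have hdφ := differentiableOn_discInvolution ha'
  have key := eqOn_id_of_map_zero_of_fixed (g := discInvolution a ∘ g ∘ discInvolution a)
    (hdφ.comp (hd.comp hdφ hφ) (hm.comp hφ)) (hφ.comp (hm.comp hφ)) (by simp [hga]) (hφ hb)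
    (fun h ↦ hab (by rw [← hinv b hb, h, discInvolution_zero]))
    (by simp [hinv b hb, hgb])
  intro w hw
  have h := key (hφ hw)
  simp only [Function.comp, hinv w hw, id] at h
  rw [id, ← hinv (g w) (hm hw), h, hinv w hw]

/-- A holomorphic map from the half-plane `1/2 < re z` to the unit disc that agrees with the
conformal map `z ↦ (1 - z) / z` at two points agrees with it everywhere. -/
lemma eq_one_sub_div_of_two_points {h : ℂ → ℂ} (hd : DifferentiableOn ℂ h {z | 1 / 2 < z.re})
    (hm : ∀ z : ℂ, 1 / 2 < z.re → ‖h z‖ < 1) {s t : ℂ} (hs : 1 / 2 < s.re) (ht : 1 / 2 < t.re)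
    (hst : s ≠ t) (hhs : h s = (1 - s) / s) (hht : h t = (1 - t) / t) {z : ℂ}
    (hz : 1 / 2 < z.re) : h z = (1 - z) / z := by
  have hne : ∀ w ∈ Metric.ball (0 : ℂ) 1, 1 + w ≠ 0 := by
    intro w hw h0
    have hw' := mem_ball_zero_iff.1 hw
    rw [show w = -1 by linear_combination h0] at hw'
    simp at hw'
  have hmap : MapsTo (fun w : ℂ ↦ (1 + w)⁻¹) (Metric.ball 0 1) {z | 1 / 2 < z.re} := by
    intro w hw
    have hpos : 0 < normSq (1 + w) := normSq_pos.2 (hne w hw)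
    have hw2 : ‖w‖ ^ 2 < 1 := by
      nlinarith [norm_nonneg w, mem_ball_zero_iff.1 hw]
    rw [Complex.sq_norm, normSq_apply] at hw2
    rw [mem_ofPred_eq, inv_re, lt_div_iff₀ hpos, normSq_apply]
    simp
    nlinarith
  have hne0 : ∀ u : ℂ, 1 / 2 < u.re → u ≠ 0 := by
    rintro u hu rfl
    norm_num at hu
  have hball : ∀ u : ℂ, 1 / 2 < u.re → (1 - u) / u ∈ Metric.ball (0 : ℂ) 1 := by
    intro u hu
    rw [mem_ball_zero_iff, norm_div, div_lt_one (norm_pos_iff.2 (hne0 u hu))]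
    refine lt_of_pow_lt_pow_left₀ 2 (norm_nonneg _) ?_
    rw [Complex.sq_norm, Complex.sq_norm, normSq_apply, normSq_apply]
    simp
    nlinarith
  have hcomp : ∀ u : ℂ, 1 / 2 < u.re → (1 + (1 - u) / u)⁻¹ = u := by
    intro u hu
    have := hne0 u hu
    field_simp
    ring
  have key := eqOn_id_of_two_fixed_points (g := fun w ↦ h (1 + w)⁻¹)
    (hd.comp (DifferentiableOn.inv (by fun_prop) hne) hmap)
    (fun w hw ↦ mem_ball_zero_iff.2 (hm _ (hmap hw))) (hball s hs) (hball t ht)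
    (fun he ↦ hst (by rw [← hcomp s hs, he, hcomp t ht]))
    (by simp only [hcomp s hs, hhs]) (by simp only [hcomp t ht, hht])
  simpa [hcomp z hz] using key (hball z hz)

lemma norm_entireXi_le_norm_entireXi_add_one {s : ℂ} (hs : 0 < s.re) :
    ‖entireXi s‖ ≤ ‖entireXi (s + 1)‖ := by
  obtain ⟨C, hC, hg⟩ := exists_norm_entireXi_div_le
  have hne : ∀ z : ℂ, 0 ≤ z.re → entireXi (z + 1) ≠ 0 := fun z hz ↦
    entireXi_ne_zero (by simpa using hz)
  have hcl : closure {z : ℂ | 0 < z.re} ⊆ {z | 0 ≤ z.re} :=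
    closure_minimal (fun z (hz : 0 < z.re) ↦ show 0 ≤ z.re from hz.le)
      (isClosed_le continuous_const continuous_re)
  have h1 : Differentiable ℂ fun z ↦ entireXi (z + 1) :=
    differentiable_entireXi.comp (differentiable_id.add_const 1)
  have hd : DiffContOnCl ℂ (fun z ↦ entireXi z / entireXi (z + 1)) {z | 0 < z.re} := by
    simp only [div_eq_mul_inv]
    exact differentiable_entireXi.diffContOnCl.smul
      (h1.diffContOnCl.inv fun z hz ↦ hne z (hcl hz))
  have := norm_le_one_of_re_pos_of_growth hd (fun z hz ↦ ?_) hC hg hs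
  · rwa [norm_div, div_le_one₀ (norm_pos_iff.2 (hne s hs.le))] at this
  · rw [norm_div, norm_entireXi_add_one hz]
    exact div_self_le_one _

/-- The factor of `heckeF p ε a s` multiplying `Λ(2s)`. -/
noncomputable def heckeCoeff (p : ℕ) (ε : ℂ) (a : ℝ) (s : ℂ) : ℂ :=
  (a : ℂ) ^ s * ((p : ℂ) ^ s + ε)

lemma heckeF_eq (p : ℕ) (ε : ℂ) (a : ℝ) (s : ℂ) :
    heckeF p ε a s = heckeCoeff p ε a s * completedRiemannZeta (2 * s) +
      heckeCoeff p ε a (1 - s) * completedRiemannZeta (2 * s - 1) := rfl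

lemma heckeF_one_sub (p : ℕ) (ε : ℂ) (a : ℝ) (s : ℂ) :
    heckeF p ε a (1 - s) = heckeF p ε a s := by
  rw [heckeF_eq, heckeF_eq, sub_sub_cancel, ← completedRiemannZeta_one_sub (2 * s),
    ← completedRiemannZeta_one_sub (2 * s - 1), add_comm]
  ring_nf

lemma heckeCoeff_conj (p : ℕ) {ε : ℂ} (hε : ε = 1 ∨ ε = -1) {a : ℝ} (ha : 0 ≤ a)
    (s : ℂ) :
    heckeCoeff p ε a (starRingEnd ℂ s) = starRingEnd ℂ (heckeCoeff p ε a s) := by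
  have hr : ∀ r : ℝ, 0 ≤ r → (r : ℂ) ^ starRingEnd ℂ s = starRingEnd ℂ ((r : ℂ) ^ s) := by
    intro r h0
    rw [cpow_conj _ _ (by rw [arg_ofReal_of_nonneg h0]; exact Real.pi_pos.ne), conj_ofReal]
  have hp0 := hr p p.cast_nonneg
  rw [ofReal_natCast] at hp0
  rw [heckeCoeff, heckeCoeff, hr a ha, hp0, map_mul, map_add]
  rcases hε with rfl | rfl <;> simp

lemma norm_natCast_cpow_one_sub_add_lt {p : ℕ} (hp : 2 ≤ p) {ε : ℂ} (hε : ε = 1 ∨ ε = -1)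
    {s : ℂ} (hs : 1 / 2 < s.re) :
    ‖(p : ℂ) ^ (1 - s) + ε‖ < ‖(p : ℂ) ^ s + ε‖ := by
  have hp0 : (0 : ℝ) < p := by exact_mod_cast (by omega : 0 < p)
  have hp2 : (2 : ℝ) ≤ p := by exact_mod_cast hp
  have hpc : (p : ℂ) ≠ 0 := by exact_mod_cast hp0.ne'
  set q := (p : ℂ) ^ s with hq
  have hr : ‖q‖ = (p : ℝ) ^ s.re := norm_natCast_cpow_of_pos (by omega) s
  have hrp : (p : ℝ) < ‖q‖ ^ 2 := by
    rw [hr, ← Real.rpow_mul_natCast hp0.le]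
    conv_lhs => rw [← Real.rpow_one (p : ℝ)]
    exact Real.rpow_lt_rpow_of_exponent_lt (by linarith) (by push_cast; linarith)
  have hr0 : 0 < ‖q‖ ^ 2 := hp0.trans hrp
  have hq0 : q ≠ 0 := fun h ↦ by simp [h] at hr0
  set k : ℝ := p / ‖q‖ ^ 2 with hk
  have hkp : k * ‖q‖ ^ 2 = p := div_mul_cancel₀ _ hr0.ne'
  have hk1 : k < 1 := (div_lt_one hr0).2 hrp
  have e : (p : ℂ) ^ (1 - s) = k * starRingEnd ℂ q := by
    rw [cpow_sub _ _ hpc, cpow_one, ← hq, div_eq_iff hq0, mul_assoc, mul_comm _ q, mul_conj,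
      ← Complex.sq_norm, ← ofReal_mul, hkp, ofReal_natCast]
  have hx := abs_le.1 (abs_re_le_norm q)
  have hxq : ‖q‖ ^ 2 = q.re * q.re + q.im * q.im := by rw [Complex.sq_norm, normSq_apply]
  rw [e]
  refine lt_of_pow_lt_pow_left₀ 2 (norm_nonneg _) ?_
  rw [Complex.sq_norm, Complex.sq_norm, normSq_apply, normSq_apply]
  have hm : ∀ δ : ℝ, (δ = 1 ∨ δ = -1) → 0 < (1 - k) * (‖q‖ ^ 2 + p + 2 * δ * q.re) := by
    rintro δ hδ
    refine mul_pos (by linarith) ?_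
    rcases hδ with rfl | rfl <;> nlinarith [sq_nonneg (‖q‖ - 1)]
  rcases hε with rfl | rfl
  · have := hm 1 (Or.inl rfl)
    rw [← hkp, hxq] at this
    simp
    nlinarith
  · have := hm (-1) (Or.inr rfl)
    rw [← hkp, hxq] at this
    simp
    nlinarith

lemma norm_heckeCoeff_one_sub_lt {p : ℕ} (hp : 2 ≤ p) {ε : ℂ} (hε : ε = 1 ∨ ε = -1)
    {a : ℝ} (ha : 1 ≤ a) {s : ℂ} (hs : 1 / 2 < s.re) :
    ‖heckeCoeff p ε a (1 - s)‖ < ‖heckeCoeff p ε a s‖ := by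
  have ha0 : 0 < a := by linarith
  rw [heckeCoeff, heckeCoeff, norm_mul, norm_mul, norm_cpow_eq_rpow_re_of_pos ha0,
    norm_cpow_eq_rpow_re_of_pos ha0]
  refine mul_lt_mul' (Real.rpow_le_rpow_of_exponent_le ha ?_)
    (norm_natCast_cpow_one_sub_add_lt hp hε hs) (norm_nonneg _) (by positivity)
  simp only [sub_re, one_re]
  linarith

lemma norm_heckeCoeff_neg_two_lt {p : ℕ} (hp : 2 ≤ p) {ε : ℂ} (hε : ε = 1 ∨ ε = -1)
    {a : ℝ} (ha : 1 ≤ a) :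
    3 * ‖heckeCoeff p ε a (1 - 3)‖ < 2 * ‖heckeCoeff p ε a 3‖ := by
  have hp2 : (2 : ℝ) ≤ p := by exact_mod_cast hp
  have hε1 : ‖ε‖ = 1 := by rcases hε with rfl | rfl <;> simp
  have ha0 : 0 < a := by linarith
  have h1 : ‖heckeCoeff p ε a (1 - 3)‖ ≤ 1 * 2 := by
    rw [heckeCoeff, norm_mul, norm_cpow_eq_rpow_re_of_pos ha0]
    gcongr
    · exact Real.rpow_le_one_of_one_le_of_nonpos ha (by norm_num)
    · refine (norm_add_le _ _).trans ?_
      rw [hε1, norm_natCast_cpow_of_pos (by omega)]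
      have := Real.rpow_le_one_of_one_le_of_nonpos (x := (p : ℝ)) (z := (1 - 3 : ℂ).re)
        (by linarith) (by norm_num)
      linarith
  have h2 : 1 * 7 ≤ ‖heckeCoeff p ε a 3‖ := by
    rw [heckeCoeff, norm_mul, norm_cpow_eq_rpow_re_of_pos ha0]
    gcongr
    · exact Real.one_le_rpow ha (by norm_num)
    · refine le_trans ?_ (norm_sub_le_norm_add _ _)
      rw [hε1, norm_natCast_cpow_of_pos (by omega)]
      have : (2 : ℝ) ^ 3 ≤ (p : ℝ) ^ 3 := by gcongr
      have e : (p : ℝ) ^ (3 : ℂ).re = (p : ℝ) ^ 3 := by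
        rw [show (3 : ℂ).re = ((3 : ℕ) : ℝ) by simp, Real.rpow_natCast]
      rw [e]
      linarith
  linarith

lemma heckeF_ne_zero_of_half_lt_re {p : ℕ} (hp : 2 ≤ p) {ε : ℂ} (hε : ε = 1 ∨ ε = -1)
    {a : ℝ} (ha : 1 ≤ a) {s : ℂ} (hs : 1 / 2 < s.re) (him : s.im ≠ 0) :
    heckeF p ε a s ≠ 0 := by
  intro hzero
  set h : ℂ → ℂ := fun z ↦ heckeCoeff p ε a (1 - z) * entireXi (2 * z - 1) /
    (heckeCoeff p ε a z * entireXi (2 * z)) with hh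
  have hA : ∀ z : ℂ, 1 / 2 < z.re → heckeCoeff p ε a z ≠ 0 := fun z hz ↦
    norm_pos_iff.1 ((norm_nonneg _).trans_lt (norm_heckeCoeff_one_sub_lt hp hε ha hz))
  have hX : ∀ z : ℂ, 1 / 2 < z.re → entireXi (2 * z) ≠ 0 := fun z hz ↦
    entireXi_ne_zero (by simp; linarith)
  have hXle : ∀ z : ℂ, 1 / 2 < z.re → ‖entireXi (2 * z - 1)‖ ≤ ‖entireXi (2 * z)‖ := by
    intro z hz
    have := norm_entireXi_le_norm_entireXi_add_one (s := 2 * z - 1) (by simp; linarith)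
    rwa [sub_add_cancel] at this
  have hdA : Differentiable ℂ (heckeCoeff p ε a) := by
    have h1 : (a : ℂ) ≠ 0 := ofReal_ne_zero.2 (by linarith)
    have h2 : (p : ℂ) ≠ 0 := by exact_mod_cast (by omega : p ≠ 0)
    exact (differentiable_id.const_cpow (Or.inl h1)).mul
      ((differentiable_id.const_cpow (Or.inl h2)).add_const ε)
  have hd : DifferentiableOn ℂ h {z | 1 / 2 < z.re} := by
    refine DifferentiableOn.div (Differentiable.differentiableOn ?_)
      (Differentiable.differentiableOn ?_) fun z hz ↦ mul_ne_zero (hA z hz) (hX z hz)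
    · exact (hdA.comp (differentiable_id.const_sub 1)).mul
        (differentiable_entireXi.comp ((differentiable_id.const_mul 2).sub_const 1))
    · exact hdA.mul (differentiable_entireXi.comp (differentiable_id.const_mul 2))
  have hm : ∀ z : ℂ, 1 / 2 < z.re → ‖h z‖ < 1 := by
    intro z hz
    have hX' := norm_pos_iff.2 (hX z hz)
    have hA' := norm_pos_iff.2 (hA z hz)
    simp only [hh, norm_div, norm_mul]
    rw [div_lt_one (by positivity)]
    exact (mul_le_mul_of_nonneg_left (hXle z hz) (norm_nonneg _)).trans_lt
      (mul_lt_mul_of_pos_right (norm_heckeCoeff_one_sub_lt hp hε ha hz) hX')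
  have hs0 : s ≠ 0 := by rintro rfl; simp at him
  have hs1 : s - 1 ≠ 0 := fun h0 ↦ him (by simpa using congrArg im h0)
  have hs2 : 2 * s - 1 ≠ 0 := fun h0 ↦ him (by simpa using congrArg im h0)
  have hhs : h s = (1 - s) / s := by
    have h1 := hA s hs
    have h2 := hX s hs
    simp only [hh]
    rw [div_eq_div_iff (mul_ne_zero h1 h2) hs0]
    rw [entireXi_eq (mul_ne_zero two_ne_zero hs0) (sub_ne_zero.1 hs2), entireXi_eq hs2
      (fun h0 ↦ hs1 (by linear_combination h0 / 2))]
    rw [heckeF_eq] at hzero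
    linear_combination (2 * s - 1) * (2 * s - 2) * s * hzero
  have hsc : 1 / 2 < (starRingEnd ℂ s).re := by simpa using hs
  have hhc : h (starRingEnd ℂ s) = (1 - starRingEnd ℂ s) / starRingEnd ℂ s := by
    have : h (starRingEnd ℂ s) = starRingEnd ℂ (h s) := by
      simp only [hh, map_div₀, map_mul]
      have ha0 : 0 ≤ a := by linarith
      rw [← heckeCoeff_conj p hε ha0, ← heckeCoeff_conj p hε ha0, ← entireXi_conj,
        ← entireXi_conj]
      · simp only [map_sub, map_mul, map_one, map_ofNat]
      all_goals
        simp
        linarith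
    rw [this, hhs]
    simp
  have hne : s ≠ starRingEnd ℂ s := fun h0 ↦ him (conj_eq_iff_im.1 h0.symm)
  have h3 := eq_one_sub_div_of_two_points hd hm hs hsc hne hhs hhc (z := 3) (by norm_num)
  have hlt := norm_heckeCoeff_neg_two_lt hp hε ha
  have hA3 := norm_pos_iff.2 (hA 3 (by norm_num))
  have hX3 := norm_pos_iff.2 (hX 3 (by norm_num))
  have hXle3 := hXle 3 (by norm_num)
  have h4 := congrArg norm h3
  simp only [hh, norm_div, norm_mul] at h4
  rw [div_eq_div_iff (by positivity) (by simp), show (1 - 3 : ℂ) = -2 by norm_num] at h4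
  rw [show (1 - 3 : ℂ) = -2 by norm_num] at hlt
  simp only [norm_neg, norm_ofNat] at h4
  have h5 : ‖heckeCoeff p ε a (-2)‖ * ‖entireXi (2 * 3 - 1)‖ ≤
    ‖heckeCoeff p ε a (-2)‖ * ‖entireXi (2 * 3)‖ := by gcongr
  nlinarith [mul_lt_mul_of_pos_right hlt hX3]

/-- For every prime `p`, every sign `ε = ±1` and every `a ≥ 1`, all non-real zeros of
`F_ε(a,·)` lie on the critical line `Re(s) = 1/2`. -/
theorem heckeF_nonreal_zeros_on_critical_line (p : ℕ) (hp : p.Prime) (ε : ℂ)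
    (hε : ε = 1 ∨ ε = -1) (a : ℝ) (ha : 1 ≤ a) (s : ℂ) (hs : s.im ≠ 0)
    (hzero : heckeF p ε a s = 0) : s.re = 1 / 2 := by
  rcases lt_trichotomy s.re (1 / 2) with h | h | h
  · refine absurd ((heckeF_one_sub p ε a s).trans hzero)
      (heckeF_ne_zero_of_half_lt_re hp.two_le hε ha ?_ (by simpa using hs))
    simp only [sub_re, one_re]
    linarith
  · exact h
  · exact absurd hzero (heckeF_ne_zero_of_half_lt_re hp.two_le hε ha h hs)
end
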